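/- arXiv:2310.02534 — 3 statements merged into one kernel-verified Lean document; each statement's English description precedes it below -/
import Mathlib

section
/- There exists a constant C > 0 such that for every real number X ≥ 16, the number of quadruples (a,b,c,d) ∈ ℤ⁴ with |a| ≤ X, |b| ≤ X, |c| ≤ X, |d| ≤ X, ad − bc ≠ 0, and such that the equation y² = (a(z² − x²) + 2bxz)² + (c(z² − x²) + 2dxz)² has a solution (x,y,z) ≠ (0,0,0) with x,y,z ∈ K, both for K = ℝ and for K = ℚ_p for every prime p, is at most C · X⁴ · (log log X)^{7/3} / (log X)^{1/4}. -/
/-- The curve `H_η`, for `η = (a b; c d)`, has a nontrivial `K`-point, i.e. the equation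
`y² = (a(z² − x²) + 2bxz)² + (c(z² − x²) + 2dxz)²` has a solution `(x,y,z) ≠ (0,0,0)` in `K`. -/
def HasPoint (K : Type*) [Field K] (a b c d : ℤ) : Prop :=
  ∃ x y z : K, (x, y, z) ≠ (0, 0, 0) ∧
    y ^ 2 = ((a : K) * (z ^ 2 - x ^ 2) + (b : K) * (2 * x * z)) ^ 2 +
      ((c : K) * (z ^ 2 - x ^ 2) + (d : K) * (2 * x * z)) ^ 2

/-- A nontrivial `p`-adic point of `H_η` can be scaled to one with integral coordinates whose
reduction modulo `p` has `(x, z) ≠ (0, 0)`. -/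
lemma HasPoint.exists_zmod {p : ℕ} [Fact p.Prime] {a b c d : ℤ} (h : HasPoint ℚ_[p] a b c d) :
    ∃ x y z : ZMod p, ¬(x = 0 ∧ z = 0) ∧
      y ^ 2 = ((a : ZMod p) * (z ^ 2 - x ^ 2) + (b : ZMod p) * (2 * x * z)) ^ 2 +
        ((c : ZMod p) * (z ^ 2 - x ^ 2) + (d : ZMod p) * (2 * x * z)) ^ 2 := by
  obtain ⟨x, y, z, hne, heq⟩ := h
  obtain ⟨t, ht, htx, htz, hmem⟩ : ∃ t : ℚ_[p], t ≠ 0 ∧ ‖x‖ ≤ ‖t‖ ∧ ‖z‖ ≤ ‖t‖ ∧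
      (t = x ∨ t = z) := by
    have hxz : x ≠ 0 ∨ z ≠ 0 := by
      by_contra! hc
      obtain ⟨rfl, rfl⟩ := hc
      apply hne
      have : y = 0 := by simpa using heq
      simp [this]
    rcases le_total ‖x‖ ‖z‖ with hle | hle
    · refine ⟨z, ?_, hle, le_rfl, Or.inr rfl⟩
      rintro rfl
      simp_all
    · refine ⟨x, ?_, le_rfl, hle, Or.inl rfl⟩
      rintro rfl
      simp_all
  have hxt : ‖x / t‖ ≤ 1 := by
    rw [norm_div]; exact div_le_one_of_le₀ htx (norm_nonneg _)
  have hzt : ‖z / t‖ ≤ 1 := by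
    rw [norm_div]; exact div_le_one_of_le₀ htz (norm_nonneg _)
  obtain ⟨x', hx'⟩ : ∃ x' : ℤ_[p], (x' : ℚ_[p]) = x / t := ⟨⟨_, hxt⟩, rfl⟩
  obtain ⟨z', hz'⟩ : ∃ z' : ℤ_[p], (z' : ℚ_[p]) = z / t := ⟨⟨_, hzt⟩, rfl⟩
  have hx : x = t * x' := by rw [hx']; field_simp
  have hz : z = t * z' := by rw [hz']; field_simp
  have hyeq : (y / t ^ 2) ^ 2 = (((a * (z' ^ 2 - x' ^ 2) + b * (2 * x' * z')) ^ 2 +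
      (c * (z' ^ 2 - x' ^ 2) + d * (2 * x' * z')) ^ 2 : ℤ_[p]) : ℚ_[p]) := by
    have h2 : ((2 : ℤ_[p]) : ℚ_[p]) = 2 := rfl
    rw [div_pow, heq, hx, hz]
    push_cast [h2]
    field_simp
  have hyt : ‖y / t ^ 2‖ ≤ 1 := by
    have h1 : ‖y / t ^ 2‖ ^ 2 ≤ 1 := by
      rw [← norm_pow, hyeq]
      exact PadicInt.norm_le_one _
    exact (sq_le_one_iff₀ (norm_nonneg _)).1 h1
  obtain ⟨y', hy'⟩ : ∃ y' : ℤ_[p], (y' : ℚ_[p]) = y / t ^ 2 := ⟨⟨_, hyt⟩, rfl⟩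
  rw [← hy'] at hyeq
  have hyeq' : y' ^ 2 = ((a * (z' ^ 2 - x' ^ 2) + b * (2 * x' * z')) ^ 2 +
      (c * (z' ^ 2 - x' ^ 2) + d * (2 * x' * z')) ^ 2 : ℤ_[p]) :=
    Subtype.ext (by exact_mod_cast hyeq)
  refine ⟨PadicInt.toZMod x', PadicInt.toZMod y', PadicInt.toZMod z', ?_, ?_⟩
  · rintro ⟨h1, h2⟩
    rcases hmem with rfl | rfl
    · rw [div_self ht] at hx'
      have : x' = 1 := Subtype.ext hx'
      simp [this] at h1
    · rw [div_self ht] at hz'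
      have : z' = 1 := Subtype.ext hz'
      simp [this] at h2
  · have := congrArg (PadicInt.toZMod (p := p)) hyeq'
    have h2 : PadicInt.toZMod (2 : ℤ_[p]) = 2 := map_ofNat _ 2
    simpa [h2] using this

/-- If `η` reduces modulo `p` to a rank one matrix `(a, as; at, ast)` with `1 + s²` and `1 + t²`
both nonsquares, then `H_η` has no `p`-adic point. -/
lemma not_hasPoint_of_rank_one {p : ℕ} [Fact p.Prime] {a b c d : ℤ} {s t : ZMod p}
    (ha : (a : ZMod p) ≠ 0) (hs : ¬IsSquare (1 + s ^ 2)) (ht : ¬IsSquare (1 + t ^ 2))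
    (hb : (b : ZMod p) = a * s) (hc : (c : ZMod p) = a * t) (hd : (d : ZMod p) = a * s * t) :
    ¬HasPoint ℚ_[p] a b c d := by
  intro h
  obtain ⟨x, y, z, hxz, heq⟩ := h.exists_zmod
  rw [hb, hc, hd] at heq
  set l := (a : ZMod p) * ((z ^ 2 - x ^ 2) + s * (2 * x * z)) with hl
  have heq' : y ^ 2 = l ^ 2 * (1 + t ^ 2) := by rw [heq, hl]; ring
  have hl0 : l = 0 := by
    by_contra hne
    exact ht ⟨y / l, by field_simp; rw [heq']; ring⟩
  have hu : z ^ 2 - x ^ 2 = -s * (2 * x * z) := by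
    have := (mul_eq_zero.1 hl0).resolve_left ha
    linear_combination this
  have hw : (x ^ 2 + z ^ 2) ^ 2 = (2 * x * z) ^ 2 * (1 + s ^ 2) := by
    linear_combination (z ^ 2 - x ^ 2 - s * (2 * x * z)) * hu
  by_cases hv : 2 * x * z = 0
  · have h1 : x ^ 2 + z ^ 2 = 0 := by
      have : (x ^ 2 + z ^ 2) ^ 2 = 0 := by rw [hw, hv]; ring
      exact pow_eq_zero_iff (two_ne_zero) |>.1 this
    have h2 : z ^ 2 = x ^ 2 := by rw [hv] at hu; linear_combination hu
    by_cases h20 : (2 : ZMod p) = 0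
    · exact hs (by
        have h3 : (1 + s ^ 2) = (1 + s) * (1 + s) := by linear_combination -s * h20
        exact ⟨_, h3⟩)
    · have hx : x = 0 := by
        have : (2 : ZMod p) * x ^ 2 = 0 := by linear_combination h1 - h2
        simpa [h20] using this
      have hz : z = 0 := by simpa [hx] using h2
      exact hxz ⟨hx, hz⟩
  · exact hs ⟨(x ^ 2 + z ^ 2) / (2 * x * z), by
      rw [div_mul_div_comm, eq_div_iff (mul_ne_zero hv hv)]; linear_combination -hw⟩

/-- The hyperbola `w² = 1 + s²` has `p - 1` points, whence `∑ χ(1 + s²) = -1`. -/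
lemma sum_quadraticChar_one_add_sq {p : ℕ} [Fact p.Prime] (hp : p ≠ 2) :
    ∑ s : ZMod p, quadraticChar (ZMod p) (1 + s ^ 2) = -1 := by
  have h2 : (2 : ZMod p) ≠ 0 := by
    have := Ring.two_ne_zero (R := ZMod p) (by rwa [ZMod.ringChar_zmod_n])
    exact this
  have hcard : Fintype.card {q : ZMod p × ZMod p // q.2 ^ 2 = 1 + q.1 ^ 2} = p - 1 := by
    rw [← ZMod.card_units p]
    symm
    refine Fintype.card_congr
      { toFun := fun u => ⟨((u - (u : ZMod p)⁻¹) / 2, (u + (u : ZMod p)⁻¹) / 2), ?_⟩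
        invFun := fun q => Units.mkOfMulEqOne (q.1.2 + q.1.1) (q.1.2 - q.1.1) ?_
        left_inv := ?_
        right_inv := ?_ }
    · have : (u : ZMod p) ≠ 0 := u.ne_zero
      field_simp
      ring
    · linear_combination q.2
    · intro u
      ext
      have : (u : ZMod p) ≠ 0 := u.ne_zero
      change ((u : ZMod p) + (u : ZMod p)⁻¹) / 2 + (u - (u : ZMod p)⁻¹) / 2 = u
      field_simp
      ring
    · rintro ⟨⟨s, w⟩, h⟩
      have h1 : (w + s) * (w - s) = 1 := by linear_combination h
      have h3 : (w + s)⁻¹ = w - s := inv_eq_of_mul_eq_one_right h1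
      ext <;> simp [h3] <;> field_simp <;> ring
  have hsum : ∑ s : ZMod p, (quadraticChar (ZMod p) (1 + s ^ 2) + 1) = (p : ℤ) - 1 := by
    have h1 : ∀ s : ZMod p, quadraticChar (ZMod p) (1 + s ^ 2) + 1 =
        ({w : ZMod p | w ^ 2 = 1 + s ^ 2} : Set (ZMod p)).toFinset.card := fun s =>
      (quadraticChar_card_sqrts (by rwa [ZMod.ringChar_zmod_n]) _).symm
    simp_rw [h1]
    rw [← Nat.cast_sum, ← Finset.card_sigma, ← Nat.cast_pred (Fact.out : p.Prime).pos, ← hcard,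
      ← Fintype.card_coe]
    congr 1
    refine Fintype.card_congr
      { toFun := fun q => ⟨(q.1.1, q.1.2), by simpa using q.2⟩
        invFun := fun q => ⟨⟨q.1.1, q.1.2⟩, by simpa using q.2⟩
        left_inv := fun q => rfl
        right_inv := fun q => rfl }
  rw [Finset.sum_add_distrib, Finset.sum_const, Finset.card_univ, ZMod.card, nsmul_one] at hsum
  linarith

lemma card_one_add_sq_not_isSquare {p : ℕ} [Fact p.Prime] (hp : p ≠ 2) :
    p - 1 ≤ 2 * Nat.card {s : ZMod p // ¬IsSquare (1 + s ^ 2)} := by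
  classical
  have h1 : ∀ s : ZMod p, (1 : ℤ) - quadraticChar (ZMod p) (1 + s ^ 2) ≤
      2 * (if ¬IsSquare (1 + s ^ 2) then 1 else 0) + if s ^ 2 = -1 then 1 else 0 := by
    intro s
    by_cases h0 : s ^ 2 = -1
    · simp [h0]
    · have h0' : 1 + s ^ 2 ≠ 0 := fun h => h0 (by linear_combination h)
      by_cases hs : IsSquare (1 + s ^ 2)
      · simp [(quadraticChar_one_iff_isSquare h0').2 hs, hs, h0]
      · simp [quadraticChar_neg_one_iff_not_isSquare.2 hs, hs, h0]
  have h2 := Finset.sum_le_sum fun s (_ : s ∈ Finset.univ) => h1 s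
  have h3 : ((Finset.univ : Finset (ZMod p)).filter (fun s => s ^ 2 = -1)).card ≤ 2 := by
    have := Polynomial.card_nthRoots 2 (-1 : ZMod p)
    refine le_trans ?_ this
    refine (Finset.card_le_card (t := (Polynomial.nthRoots 2 (-1 : ZMod p)).toFinset) ?_).trans
      (Multiset.toFinset_card_le _)
    intro s hs
    simpa [Polynomial.mem_nthRoots] using hs
  rw [Finset.sum_sub_distrib, sum_quadraticChar_one_add_sq hp, Finset.sum_add_distrib,
    ← Finset.mul_sum, Finset.sum_boole, Finset.sum_boole] at h2
  simp only [Finset.sum_const, Finset.card_univ, ZMod.card] at h2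
  rw [Nat.card_eq_fintype_card, Fintype.card_subtype]
  simp at h2
  omega

/-- For every odd prime `p` there are at least `(p - 1)³ / 4` matrices modulo `p` obstructing
`p`-adic solubility. -/
lemma exists_obstructing_residues (p : ℕ) : ∃ Ω : Finset (Fin 4 → ZMod p),
    ∀ [Fact p.Prime], p ≠ 2 → (p - 1 : ℝ) ^ 3 / 4 ≤ Ω.card ∧
      ∀ v : Fin 4 → ℤ, (fun i => (v i : ZMod p)) ∈ Ω → ¬HasPoint ℚ_[p] (v 0) (v 1) (v 2) (v 3) := by
  classical
  by_cases hp : p.Prime ∧ p ≠ 2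
  swap
  · exact ⟨∅, fun h => absurd ⟨‹Fact p.Prime›.out, h⟩ hp⟩
  have : Fact p.Prime := ⟨hp.1⟩
  let T := {s : ZMod p // ¬IsSquare (1 + s ^ 2)}
  let F : (ZMod p)ˣ × T × T → (Fin 4 → ZMod p) := fun q =>
    ![q.1, q.1 * q.2.1.1, q.1 * q.2.2.1, q.1 * q.2.1.1 * q.2.2.1]
  have hF : Function.Injective F := by
    rintro ⟨a, ⟨s, hs⟩, ⟨t, ht⟩⟩ ⟨a', ⟨s', hs'⟩, ⟨t', ht'⟩⟩ h
    have h0 : (a : ZMod p) = a' := congrFun h 0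
    have h1 : (a : ZMod p) * s = a' * s' := congrFun h 1
    have h2 : (a : ZMod p) * t = a' * t' := congrFun h 2
    obtain rfl : a = a' := Units.ext h0
    simp_all
  refine ⟨Finset.univ.image F, fun _ => ⟨?_, ?_⟩⟩
  · rw [Finset.card_image_of_injective _ hF, Finset.card_univ, Fintype.card_prod,
      Fintype.card_prod, ZMod.card_units p, ← Nat.card_eq_fintype_card]
    have h := card_one_add_sq_not_isSquare hp.2
    have h' : (p - 1 : ℝ) ≤ 2 * Nat.card T := by
      rw [← Nat.cast_pred hp.1.pos]
      exact_mod_cast h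
    have h1 : (0 : ℝ) ≤ p - 1 := by
      rw [← Nat.cast_pred hp.1.pos]; positivity
    push_cast [Nat.cast_pred hp.1.pos]
    nlinarith [mul_le_mul h' h' h1 (h1.trans h'), mul_le_mul_of_nonneg_left
      (mul_le_mul h' h' h1 (h1.trans h')) h1]
  · intro v hv
    obtain ⟨⟨a, ⟨s, hs⟩, ⟨t, ht⟩⟩, -, h⟩ := Finset.mem_image.1 hv
    have h0 : (a : ZMod p) = v 0 := congrFun h 0
    have h1 : (a : ZMod p) * s = v 1 := congrFun h 1
    have h2 : (a : ZMod p) * t = v 2 := congrFun h 2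
    have h3 : (a : ZMod p) * s * t = v 3 := congrFun h 3
    rw [h0] at h1 h2 h3
    exact not_hasPoint_of_rank_one (h0 ▸ a.ne_zero) hs ht h1.symm h2.symm h3.symm

/-- Bonferroni's inequality: the alternating sum over subsets, truncated at an even size,
majorizes the indicator of the empty set. -/
lemma indicator_empty_le_truncated_sum {ι : Type*} (T : Finset ι) [Decidable (T = ∅)] {r : ℕ}
    (hr : Even r) :
    (if T = ∅ then 1 else 0 : ℝ) ≤ ∑ S ∈ T.powerset with S.card ≤ r, (-1 : ℝ) ^ S.card := by
  have h1 : ∑ S ∈ T.powerset with S.card ≤ r, (-1 : ℝ) ^ S.card =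
      ((∑ m ∈ Finset.range (r + 1), ((-1) ^ m * T.card.choose m : ℤ) : ℤ) : ℝ) := by
    rw [← Finset.sum_fiberwise_of_maps_to (g := Finset.card) (t := Finset.range (r + 1))
      (fun S hS => by simp at hS ⊢; omega)]
    push_cast
    refine Finset.sum_congr rfl fun k hk => ?_
    have h2 : ({S ∈ {S ∈ T.powerset | S.card ≤ r} | S.card = k}) = Finset.powersetCard k T := by
      ext S
      simp only [Finset.mem_filter, Finset.mem_powerset, Finset.mem_powersetCard]
      have := Finset.mem_range.1 hk
      grind
    rw [h2, Finset.sum_congr rfl (g := fun _ => (-1 : ℝ) ^ k)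
      (fun S hS => by rw [(Finset.mem_powersetCard.1 hS).2]), Finset.sum_const,
      Finset.card_powersetCard, nsmul_eq_mul, mul_comm]
  rw [h1]
  rcases T.eq_empty_or_nonempty with rfl | hT
  · rw [Finset.sum_range_succ']
    simp
  · obtain ⟨n, hn⟩ := Nat.exists_eq_succ_of_ne_zero hT.card_pos.ne'
    rw [hn, Nat.succ_eq_add_one, Int.alternating_sum_range_choose_eq_choose, hr.neg_one_pow,
      if_neg hT.ne_empty]
    positivity

/-- The integer vectors in `[-N, N]⁴`. -/
noncomputable def integerBox (N : ℕ) : Finset (Fin 4 → ℤ) :=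
  Fintype.piFinset fun _ => Finset.Ico (-N : ℤ) (N + 1)

lemma abs_card_Ico_filter_zmod_sub_le {d : ℕ} (hd : 0 < d) (N : ℕ) (w : ZMod d) :
    |(((Finset.Ico (-N : ℤ) (N + 1)).filter (fun x : ℤ => (x : ZMod d) = w)).card : ℝ) -
      (2 * N + 1) / d| ≤ 1 := by
  obtain ⟨k, rfl⟩ := ZMod.intCast_surjective w
  have h1 : ((Finset.Ico (-N : ℤ) (N + 1)).filter (fun x : ℤ => (x : ZMod d) = (k : ZMod d))) =
      (Finset.Ico (-N : ℤ) (N + 1)).filter (fun x : ℤ => x ≡ k [ZMOD (d : ℤ)]) := by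
    simp only [ZMod.intCast_eq_intCast_iff]
  have h2 := Int.Ico_filter_modEq_card (-N : ℤ) (N + 1) (r := (d : ℤ)) (by exact_mod_cast hd) k
  rw [← h1] at h2
  set m := ((Finset.Ico (-N : ℤ) (N + 1)).filter (fun x : ℤ => (x : ZMod d) = (k : ZMod d))).card
  have hd' : (0 : ℚ) < d := by exact_mod_cast hd
  push_cast at h2
  set u : ℚ := (N + 1 - k) / d with hu
  set l : ℚ := (-N - k) / d with hl
  have hul : u - l = (2 * N + 1) / d := by rw [hu, hl]; ring
  have hA : (0 : ℚ) < (2 * N + 1) / d := by positivity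
  have hq : |(m : ℚ) - (2 * N + 1) / d| ≤ 1 := by
    have h3 := Int.ceil_lt_add_one u
    have h4 := Int.ceil_lt_add_one l
    have h5 := Int.le_ceil u
    have h6 := Int.le_ceil l
    have h7 : (m : ℚ) = max ((⌈u⌉ : ℚ) - ⌈l⌉) 0 := by
      have : ((m : ℤ) : ℚ) = ((max (⌈u⌉ - ⌈l⌉) 0 : ℤ) : ℚ) := by rw [h2]
      push_cast at this
      exact this
    rw [h7, abs_le]
    rcases max_cases ((⌈u⌉ : ℚ) - ⌈l⌉) 0 with ⟨h, h'⟩ | ⟨h, h'⟩ <;> rw [h] <;>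
      constructor <;> linarith
  have hq' := (Rat.cast_le (K := ℝ)).2 hq
  push_cast at hq'
  exact hq'

lemma abs_prod_fin_four_sub_pow_le {A : ℝ} (hA : 1 ≤ A) {m : Fin 4 → ℝ}
    (hm : ∀ i, |m i - A| ≤ 1) : |∏ i, m i - A ^ 4| ≤ 15 * A ^ 3 := by
  have hl : ∀ i, A - 1 ≤ m i := fun i => by linarith [(abs_le.1 (hm i)).1]
  have hu : ∀ i, m i ≤ A + 1 := fun i => by linarith [(abs_le.1 (hm i)).2]
  have h1 : (A - 1) ^ 4 ≤ ∏ i, m i := by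
    have := Finset.prod_le_prod (s := Finset.univ) (fun i _ => sub_nonneg.2 hA) (fun i _ => hl i)
    simpa using this
  have h2 : ∏ i, m i ≤ (A + 1) ^ 4 := by
    have := Finset.prod_le_prod (s := Finset.univ)
      (fun i _ => (sub_nonneg.2 hA).trans (hl i)) (fun i _ => hu i)
    simpa using this
  have hA2 : A ≤ A ^ 2 := by nlinarith
  have hA3 : A ^ 2 ≤ A ^ 3 := by nlinarith [sq_nonneg A]
  rw [abs_le]
  constructor <;> nlinarith

/-- The number of points of the box in prescribed residue classes modulo `d`. -/
lemma abs_card_integerBox_filter_sub_le {d : ℕ} (hd : 0 < d) {N : ℕ} (hN : d ≤ 2 * N + 1)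
    (Ω : Finset (Fin 4 → ZMod d)) :
    |(((integerBox N).filter (fun v => (fun i => (v i : ZMod d)) ∈ Ω)).card : ℝ) -
      Ω.card * ((2 * N + 1) / d) ^ 4| ≤
        (Ω.card : ℝ) * (15 * ((2 * N + 1) / d) ^ 3) := by
  classical
  have hA : (1 : ℝ) ≤ (2 * N + 1) / d := by
    rw [one_le_div (by exact_mod_cast hd)]
    exact_mod_cast hN
  rw [Finset.card_eq_sum_card_fiberwise (f := fun v : Fin 4 → ℤ => fun i => (v i : ZMod d)) (t := Ω)
    (s := (integerBox N).filter (fun v => (fun i => (v i : ZMod d)) ∈ Ω))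
    (fun v hv => (Finset.mem_filter.1 hv).2)]
  have h1 : ∀ w ∈ Ω, ({v ∈ (integerBox N).filter (fun v => (fun i => (v i : ZMod d)) ∈ Ω) |
      (fun i => (v i : ZMod d)) = w}) = Fintype.piFinset fun i =>
        (Finset.Ico (-N : ℤ) (N + 1)).filter (fun x : ℤ => (x : ZMod d) = w i) := by
    intro w hw
    ext v
    simp only [integerBox, Finset.mem_filter, Fintype.mem_piFinset, funext_iff]
    constructor
    · rintro ⟨⟨h1, -⟩, h2⟩ i
      exact ⟨h1 i, h2 i⟩
    · intro h
      refine ⟨⟨fun i => (h i).1, ?_⟩, fun i => (h i).2⟩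
      rwa [show (fun i => (v i : ZMod d)) = w from funext fun i => (h i).2]
  rw [Finset.sum_congr rfl fun w hw => by rw [h1 w hw, Fintype.card_piFinset]]
  push_cast
  rw [← nsmul_eq_mul, ← nsmul_eq_mul, ← Finset.sum_const, ← Finset.sum_const,
    ← Finset.sum_sub_distrib]
  exact (Finset.abs_sum_le_sum_abs _ _).trans (Finset.sum_le_sum fun w _ =>
    abs_prod_fin_four_sub_pow_le hA fun i => abs_card_Ico_filter_zmod_sub_le hd N (w i))

/-- The Chinese remainder theorem for sets of residues. -/
lemma exists_residues_prod {S : Finset ℕ} (hS : ∀ p ∈ S, p.Prime)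
    (Ω : (p : ℕ) → Finset (Fin 4 → ZMod p)) :
    ∃ Ω' : Finset (Fin 4 → ZMod (∏ p ∈ S, p)), Ω'.card = ∏ p ∈ S, (Ω p).card ∧
      ∀ v : Fin 4 → ℤ, (fun i => (v i : ZMod (∏ p ∈ S, p))) ∈ Ω' ↔
        ∀ p ∈ S, (fun i => (v i : ZMod p)) ∈ Ω p := by
  classical
  induction S using Finset.induction_on with
  | empty =>
    refine ⟨{fun _ => 0}, (Finset.card_singleton _).trans Finset.prod_empty.symm, fun v => ?_⟩
    have : Subsingleton (ZMod (∏ p ∈ (∅ : Finset ℕ), p)) := by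
      rw [Finset.prod_empty]; infer_instance
    simp only [Finset.mem_singleton, Finset.notMem_empty, false_imp_iff, implies_true, iff_true]
    exact Subsingleton.elim _ _
  | insert p S hp ih =>
    obtain ⟨Ω', hcard, hmem⟩ := ih fun q hq => hS q (Finset.mem_insert_of_mem hq)
    have hcop : Nat.Coprime p (∏ q ∈ S, q) := Nat.Coprime.prod_right fun q hq =>
      (Nat.coprime_primes (hS p (Finset.mem_insert_self _ _))
        (hS q (Finset.mem_insert_of_mem hq))).2 (by rintro rfl; exact hp hq)
    rw [Finset.prod_insert hp]
    let e := ZMod.chineseRemainder hcop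
    let F : (Fin 4 → ZMod p) × (Fin 4 → ZMod (∏ q ∈ S, q)) → Fin 4 → ZMod (p * ∏ q ∈ S, q) :=
      fun q i => e.symm (q.1 i, q.2 i)
    have hF : Function.Injective F := by
      rintro ⟨f, g⟩ ⟨f', g'⟩ h
      have h' : ∀ i, f i = f' i ∧ g i = g' i := fun i =>
        Prod.mk.inj (e.symm.injective (congrFun h i))
      exact Prod.ext (funext fun i => (h' i).1) (funext fun i => (h' i).2)
    refine ⟨(Ω p ×ˢ Ω').image F, ?_, fun v => ?_⟩
    · rw [Finset.card_image_of_injective _ hF, Finset.card_product, hcard, Finset.prod_insert hp]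
    · have hv : (fun i => (v i : ZMod (p * ∏ q ∈ S, q))) =
          F (fun i => (v i : ZMod p), fun i => (v i : ZMod (∏ q ∈ S, q))) := by
        funext i
        change _ = e.symm _
        rw [RingEquiv.eq_symm_apply, map_intCast]
        rfl
      rw [hv, hF.mem_finset_image, Finset.mem_product, hmem, Finset.forall_mem_insert]

lemma abs_card_integerBox_filter_forall_sub_le {S : Finset ℕ} (hS : ∀ p ∈ S, p.Prime)
    (Ω : (p : ℕ) → Finset (Fin 4 → ZMod p)) {N : ℕ} (hN : ∏ p ∈ S, p ≤ 2 * N + 1) :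
    |(((integerBox N).filter (fun v => ∀ p ∈ S, (fun i => (v i : ZMod p)) ∈ Ω p)).card : ℝ) -
      (2 * N + 1) ^ 4 * ∏ p ∈ S, ((Ω p).card / (p : ℝ) ^ 4)| ≤
        15 * (2 * N + 1) ^ 3 * ∏ p ∈ S, (p : ℝ) := by
  classical
  obtain ⟨Ω', hcard, hmem⟩ := exists_residues_prod hS Ω
  have hd : 0 < ∏ p ∈ S, p := Finset.prod_pos fun p hp => (hS p hp).pos
  have : NeZero (∏ p ∈ S, p) := ⟨hd.ne'⟩
  have h := abs_card_integerBox_filter_sub_le hd hN Ω'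
  simp only [hmem] at h
  have hd' : (0 : ℝ) < ∏ p ∈ S, (p : ℝ) := by
    rw [← Nat.cast_prod]; exact_mod_cast hd
  have h1 : (Ω'.card : ℝ) * ((2 * N + 1) / (∏ p ∈ S, p : ℕ)) ^ 4 =
      (2 * N + 1) ^ 4 * ∏ p ∈ S, ((Ω p).card / (p : ℝ) ^ 4) := by
    rw [hcard, Finset.prod_div_distrib, Finset.prod_pow]
    push_cast
    field_simp
  have h2 : (Ω'.card : ℝ) ≤ (∏ p ∈ S, (p : ℝ)) ^ 4 := by
    have := Finset.card_le_univ Ω'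
    rw [Fintype.card_fun, ZMod.card, Fintype.card_fin] at this
    rw [← Nat.cast_prod]
    exact_mod_cast this
  rw [h1] at h
  refine h.trans ?_
  calc (Ω'.card : ℝ) * (15 * ((2 * N + 1) / (∏ p ∈ S, p : ℕ)) ^ 3)
      ≤ (∏ p ∈ S, (p : ℝ)) ^ 4 * (15 * ((2 * N + 1) / (∏ p ∈ S, p : ℕ)) ^ 3) := by gcongr
    _ = 15 * (2 * N + 1) ^ 3 * ∏ p ∈ S, (p : ℝ) := by
      push_cast
      field_simp

lemma truncated_sum_prod_le {ι : Type*} (P : Finset ι) (f : ι → ℝ) (hf0 : ∀ i ∈ P, 0 ≤ f i)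
    (hf1 : ∀ i ∈ P, f i ≤ 1) (r : ℕ) :
    ∑ S ∈ P.powerset with S.card ≤ r, (-1 : ℝ) ^ S.card * ∏ i ∈ S, f i ≤
      Real.exp (-∑ i ∈ P, f i) + Real.exp (3 * ∑ i ∈ P, f i - r) := by
  have h1 : ∏ i ∈ P, (1 + -f i) = ∑ S ∈ P.powerset, (-1 : ℝ) ^ S.card * ∏ i ∈ S, f i := by
    rw [Finset.prod_one_add]
    refine Finset.sum_congr rfl fun S _ => ?_
    rw [Finset.prod_neg]
  have h2 : ∏ i ∈ P, (1 + -f i) ≤ Real.exp (-∑ i ∈ P, f i) := by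
    rw [← Finset.sum_neg_distrib, Real.exp_sum]
    refine Finset.prod_le_prod (fun i hi => by linarith [hf1 i hi]) fun i _ => ?_
    linarith [Real.add_one_le_exp (-f i)]
  have h3 : ∑ S ∈ P.powerset with ¬S.card ≤ r, -((-1 : ℝ) ^ S.card * ∏ i ∈ S, f i) ≤
      Real.exp (-r) * ∏ i ∈ P, (1 + Real.exp 1 * f i) := by
    rw [Finset.prod_one_add, Finset.mul_sum]
    have hnn : ∀ S ∈ P.powerset, 0 ≤ ∏ i ∈ S, f i := fun S hS =>
      Finset.prod_nonneg fun i hi => hf0 i (Finset.mem_powerset.1 hS hi)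
    refine (Finset.sum_le_sum fun S hS => ?_).trans
      (Finset.sum_le_sum_of_subset_of_nonneg (Finset.filter_subset _ _) fun S hS _ => ?_)
    · obtain ⟨hS, hr⟩ := Finset.mem_filter.1 hS
      rw [Finset.prod_mul_distrib, Finset.prod_const, ← Real.exp_nat_mul, mul_one, ← mul_assoc,
        ← Real.exp_add, ← neg_mul]
      refine mul_le_mul_of_nonneg_right ?_ (hnn S hS)
      have h4 : (1 : ℝ) ≤ Real.exp (-r + S.card) := by
        rw [Real.one_le_exp_iff]
        have : (r : ℝ) ≤ S.card := by exact_mod_cast (not_le.1 hr).le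
        linarith
      rcases neg_one_pow_eq_or ℝ S.card with h | h <;> rw [h] <;> linarith
    · rw [Finset.prod_mul_distrib]
      have := hnn S hS
      positivity
  have h4 : ∏ i ∈ P, (1 + Real.exp 1 * f i) ≤ Real.exp (3 * ∑ i ∈ P, f i) := by
    rw [Finset.mul_sum, Real.exp_sum]
    refine Finset.prod_le_prod (fun i hi => ?_) fun i hi => ?_
    · have := hf0 i hi
      positivity
    · have h5 := Real.add_one_le_exp (3 * f i)
      nlinarith [Real.exp_one_lt_d9, hf0 i hi]
  have h5 := Finset.sum_filter_add_sum_filter_not P.powerset (fun S => S.card ≤ r)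
    (fun S => (-1 : ℝ) ^ S.card * ∏ i ∈ S, f i)
  rw [Finset.sum_neg_distrib] at h3
  have h6 := mul_le_mul_of_nonneg_left h4 (Real.exp_pos (-r)).le
  rw [← Real.exp_add, neg_add_eq_sub] at h6
  linarith

lemma truncated_sum_prod_primes_le {P : Finset ℕ} {z : ℕ} (hz : 0 < z)
    (hP : ∀ p ∈ P, 0 < p ∧ p ≤ z) (r : ℕ) :
    ∑ S ∈ P.powerset with S.card ≤ r, ∏ p ∈ S, (p : ℝ) ≤ 3 * (z : ℝ) ^ (2 * r) := by
  have hz1 : (1 : ℝ) ≤ z := by exact_mod_cast hz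
  have hz0 : (0 : ℝ) < z := by linarith
  have h1 : ∑ S ∈ P.powerset with S.card ≤ r, ∏ p ∈ S, (p : ℝ) ≤
      (z : ℝ) ^ (2 * r) * ∏ p ∈ P, (1 + p / (z : ℝ) ^ 2) := by
    rw [Finset.prod_one_add, Finset.mul_sum]
    refine (Finset.sum_le_sum fun S hS => ?_).trans
      (Finset.sum_le_sum_of_subset_of_nonneg (Finset.filter_subset _ _) fun S hS _ => ?_)
    · obtain ⟨-, hr⟩ := Finset.mem_filter.1 hS
      rw [Finset.prod_div_distrib, Finset.prod_const, ← pow_mul, ← mul_div_assoc,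
        le_div_iff₀ (by positivity), mul_comm]
      gcongr
    · positivity
  have h2 : ∏ p ∈ P, (1 + p / (z : ℝ) ^ 2) ≤ Real.exp 1 := by
    calc ∏ p ∈ P, (1 + p / (z : ℝ) ^ 2) ≤ ∏ p ∈ P, Real.exp (1 / z) := by
          refine Finset.prod_le_prod (fun p _ => by positivity) fun p hp => ?_
          have h3 : (p : ℝ) / (z : ℝ) ^ 2 ≤ 1 / z := by
            have : (p : ℝ) ≤ z := by exact_mod_cast (hP p hp).2
            rw [div_le_div_iff₀ (by positivity) hz0]
            nlinarith
          linarith [Real.add_one_le_exp (1 / (z : ℝ))]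
      _ = Real.exp (P.card * (1 / z)) := by rw [Finset.prod_const, ← Real.exp_nat_mul]
      _ ≤ Real.exp 1 := by
          have hc : P.card ≤ z := by
            simpa using Finset.card_le_card (t := Finset.Icc 1 z) fun p hp =>
              Finset.mem_Icc.2 (hP p hp)
          have hc' : (P.card : ℝ) ≤ z := by exact_mod_cast hc
          gcongr
          rw [mul_one_div]
          exact div_le_one_of_le₀ hc' hz0.le
  have h3 := Real.exp_one_lt_d9
  calc _ ≤ _ := h1
    _ ≤ (z : ℝ) ^ (2 * r) * 3 := by gcongr; linarith
    _ = _ := mul_comm _ _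

/-- Brun's pure sieve for integer vectors avoiding given residues modulo the primes in `P`. -/
lemma card_sifted_integerBox_le {P : Finset ℕ} (hP : ∀ p ∈ P, p.Prime)
    (Ω : (p : ℕ) → Finset (Fin 4 → ZMod p)) {z r N : ℕ} (hz : 0 < z) (hPz : ∀ p ∈ P, p ≤ z)
    (hr : Even r) (hN : z ^ r ≤ 2 * N + 1) :
    (((integerBox N).filter (fun v => ∀ p ∈ P, (fun i => (v i : ZMod p)) ∉ Ω p)).card : ℝ) ≤
      (2 * N + 1) ^ 4 * (Real.exp (-∑ p ∈ P, ((Ω p).card / (p : ℝ) ^ 4)) +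
        Real.exp (3 * ∑ p ∈ P, ((Ω p).card / (p : ℝ) ^ 4) - r)) +
      45 * (2 * N + 1) ^ 3 * (z : ℝ) ^ (2 * r) := by
  classical
  let T : (Fin 4 → ℤ) → Finset ℕ := fun v => P.filter (fun p => (fun i => (v i : ZMod p)) ∈ Ω p)
  have h1 : (((integerBox N).filter
      (fun v => ∀ p ∈ P, (fun i => (v i : ZMod p)) ∉ Ω p)).card : ℝ) =
      ∑ v ∈ integerBox N, if T v = ∅ then (1 : ℝ) else 0 := by
    rw [Finset.sum_boole]
    congr 2
    ext v
    simp [T, Finset.filter_eq_empty_iff]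
  have h2 : ∑ v ∈ integerBox N, ∑ S ∈ (T v).powerset with S.card ≤ r, (-1 : ℝ) ^ S.card =
      ∑ S ∈ P.powerset with S.card ≤ r, (-1 : ℝ) ^ S.card * (((integerBox N).filter
        (fun v => ∀ p ∈ S, (fun i => (v i : ZMod p)) ∈ Ω p)).card : ℝ) := by
    have h3 : ∀ v, ({S ∈ (T v).powerset | S.card ≤ r}) = {S ∈ {S ∈ P.powerset | S.card ≤ r} |
        ∀ p ∈ S, (fun i => (v i : ZMod p)) ∈ Ω p} := by
      intro v
      ext S
      simp only [T, Finset.mem_filter, Finset.mem_powerset, Finset.subset_iff]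
      grind
    simp_rw [h3, Finset.sum_filter _ (s := Finset.filter _ _)]
    rw [Finset.sum_comm]
    refine Finset.sum_congr rfl fun S _ => ?_
    rw [← Finset.sum_filter, Finset.sum_const, nsmul_eq_mul, mul_comm]
  have h3 : ∀ S ∈ ({S ∈ P.powerset | S.card ≤ r}), (-1 : ℝ) ^ S.card * (((integerBox N).filter
        (fun v => ∀ p ∈ S, (fun i => (v i : ZMod p)) ∈ Ω p)).card : ℝ) ≤
      (2 * N + 1) ^ 4 * ((-1 : ℝ) ^ S.card * ∏ p ∈ S, ((Ω p).card / (p : ℝ) ^ 4)) +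
        15 * (2 * N + 1) ^ 3 * ∏ p ∈ S, (p : ℝ) := by
    intro S hS
    obtain ⟨hSP, hSr⟩ := Finset.mem_filter.1 hS
    rw [Finset.mem_powerset] at hSP
    have hle : ∏ p ∈ S, p ≤ 2 * N + 1 :=
      (Finset.prod_le_pow_card S _ z fun p hp => hPz p (hSP hp)).trans
        ((Nat.pow_le_pow_right hz hSr).trans hN)
    have h4 := abs_le.1 (abs_card_integerBox_filter_forall_sub_le (fun p hp => hP p (hSP hp)) Ω hle)
    rcases neg_one_pow_eq_or ℝ S.card with h | h <;> rw [h] <;> linarith [h4.1, h4.2]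
  rw [h1]
  refine (Finset.sum_le_sum fun v _ => indicator_empty_le_truncated_sum (T v) hr).trans ?_
  rw [h2]
  refine (Finset.sum_le_sum h3).trans ?_
  rw [Finset.sum_add_distrib, ← Finset.mul_sum, ← Finset.mul_sum]
  have h5 := truncated_sum_prod_le P (fun p => ((Ω p).card / (p : ℝ) ^ 4))
    (fun p _ => by positivity) (fun p hp => by
      have : NeZero p := ⟨(hP p hp).ne_zero⟩
      have h6 := Finset.card_le_univ (Ω p)
      rw [Fintype.card_fun, ZMod.card, Fintype.card_fin] at h6
      exact div_le_one_of_le₀ (by exact_mod_cast h6) (by positivity)) r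
  have h6 := truncated_sum_prod_primes_le hz (fun p hp => ⟨(hP p hp).pos, hPz p hp⟩) r
  have h7 := mul_le_mul_of_nonneg_left h5 (show (0 : ℝ) ≤ (2 * N + 1) ^ 4 by positivity)
  have h8 := mul_le_mul_of_nonneg_left h6 (show (0 : ℝ) ≤ 15 * (2 * N + 1) ^ 3 by positivity)
  linarith

/-- The primes `p ≤ z` satisfy `∏ (1 - 1/p)⁻¹ ≥ log z`. -/
lemma log_le_prod_primesBelow (z : ℕ) :
    Real.log z ≤ ∏ p ∈ (z + 1).primesBelow, (1 - (p : ℝ)⁻¹)⁻¹ := by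
  let f : ℕ →* ℝ :=
    { toFun := fun n => (n : ℝ)⁻¹
      map_one' := by simp
      map_mul' := fun m n => by push_cast; rw [mul_inv] }
  obtain ⟨hs, hsum⟩ := EulerProduct.summable_and_hasSum_smoothNumbers_prod_primesBelow_geometric
    (f := f) (fun {p} hp => by
      change ‖(p : ℝ)⁻¹‖ < 1
      rw [norm_inv, Real.norm_natCast]
      exact inv_lt_one_of_one_lt₀ (by exact_mod_cast hp.one_lt)) (z + 1)
  change Real.log z ≤ ∏ p ∈ (z + 1).primesBelow, (1 - f p)⁻¹
  rw [← hsum.tsum_eq]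
  let g : {n // n ∈ Finset.Icc 1 z} → (z + 1).smoothNumbers := fun n =>
    ⟨n.1, Nat.mem_smoothNumbers_of_lt (Finset.mem_Icc.1 n.2).1
      (Nat.lt_succ_of_le (Finset.mem_Icc.1 n.2).2)⟩
  have hg : Function.Injective g := fun m n h => Subtype.ext (congrArg (fun x => x.1) h)
  have h1 : ∑ n ∈ Finset.univ.map ⟨g, hg⟩, f n ≤ ∑' n : (z + 1).smoothNumbers, f n :=
    hsum.summable.sum_le_tsum _ fun n _ => by
      change (0 : ℝ) ≤ ((n : ℕ) : ℝ)⁻¹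
      positivity
  refine le_trans ?_ h1
  rw [Finset.sum_map]
  change _ ≤ ∑ n : {n // n ∈ Finset.Icc 1 z}, ((n : ℕ) : ℝ)⁻¹
  rw [Finset.sum_coe_sort (Finset.Icc 1 z) (fun n : ℕ => (n : ℝ)⁻¹)]
  rcases Nat.eq_zero_or_pos z with rfl | hz
  · simp
  have h2 := log_add_one_le_harmonic z
  rw [harmonic_eq_sum_Icc] at h2
  push_cast at h2
  refine le_trans (Real.log_le_log (by exact_mod_cast hz) (by linarith)) h2

/-- A lower bound of Mertens type for a density close to `1 / (4p)` on the odd primes. -/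
lemma exists_log_log_le_sum_density : ∃ C : ℝ, 0 ≤ C ∧ ∀ w : ℕ → ℝ,
    (∀ p : ℕ, p.Prime → p ≠ 2 → ((p : ℝ) - 1) ^ 3 / 4 / (p : ℝ) ^ 4 ≤ w p) →
    ∀ z : ℕ, 2 ≤ z → Real.log (Real.log z) / 4 - C ≤
      ∑ p ∈ (z + 1).primesBelow.erase 2, w p := by
  have hsm : Summable fun n : ℕ => 5 * ((n : ℝ) ^ 2)⁻¹ :=
    (Real.summable_nat_pow_inv.2 one_lt_two).mul_left 5
  refine ⟨(1 + ∑' n : ℕ, 5 * ((n : ℝ) ^ 2)⁻¹) / 4, ?_, fun w hw z hz => ?_⟩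
  · have : 0 ≤ ∑' n : ℕ, 5 * ((n : ℝ) ^ 2)⁻¹ := tsum_nonneg fun n => by positivity
    positivity
  have hlog : 0 < Real.log z := Real.log_pos (by exact_mod_cast hz)
  have hprime : ∀ p ∈ (z + 1).primesBelow, p.Prime := fun p => Nat.prime_of_mem_primesBelow
  have h1 : Real.log z ≤ Real.exp (∑ p ∈ (z + 1).primesBelow, ((p : ℝ) - 1)⁻¹) := by
    refine (log_le_prod_primesBelow z).trans ?_
    rw [Real.exp_sum]
    refine Finset.prod_le_prod (fun p hp => ?_) fun p hp => ?_
    · have : (1 : ℝ) < p := by exact_mod_cast (hprime p hp).one_lt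
      have := inv_lt_one_of_one_lt₀ this
      exact inv_nonneg.2 (by linarith)
    · have h2 : (1 : ℝ) < p := by exact_mod_cast (hprime p hp).one_lt
      have h3 : (1 - (p : ℝ)⁻¹)⁻¹ = ((p : ℝ) - 1)⁻¹ + 1 := by
        have : (p : ℝ) - 1 ≠ 0 := by linarith
        field_simp
        ring
      rw [h3]
      exact Real.add_one_le_exp _
  have h2 : Real.log (Real.log z) ≤ ∑ p ∈ (z + 1).primesBelow, ((p : ℝ) - 1)⁻¹ :=
    (Real.log_le_iff_le_exp hlog).2 h1
  have htwo : 2 ∈ (z + 1).primesBelow := Nat.mem_primesBelow.2 ⟨by omega, Nat.prime_two⟩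
  rw [← Finset.add_sum_erase _ _ htwo] at h2
  have h3 : ∑ p ∈ (z + 1).primesBelow.erase 2, ((p : ℝ) - 1)⁻¹ ≤
      ∑ p ∈ (z + 1).primesBelow.erase 2, (4 * w p + 5 * ((p : ℝ) ^ 2)⁻¹) := by
    refine Finset.sum_le_sum fun p hp => ?_
    obtain ⟨hp2, hp⟩ := Finset.mem_erase.1 hp
    have h4 := hw p (hprime p hp) hp2
    have h5 : (2 : ℝ) ≤ p := by exact_mod_cast (hprime p hp).two_le
    have h6 : ((p : ℝ) - 1)⁻¹ ≤ 4 * (((p : ℝ) - 1) ^ 3 / 4 / (p : ℝ) ^ 4) + 5 * ((p : ℝ) ^ 2)⁻¹ := by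
      have h7 : 0 < (p : ℝ) - 1 := by linarith
      rw [← sub_nonneg]
      have : 4 * (((p : ℝ) - 1) ^ 3 / 4 / (p : ℝ) ^ 4) + 5 * ((p : ℝ) ^ 2)⁻¹ - ((p : ℝ) - 1)⁻¹ =
          (((p : ℝ) - 1) ^ 4 + 5 * (p : ℝ) ^ 2 * (p - 1) - (p : ℝ) ^ 4) /
            ((p : ℝ) ^ 4 * (p - 1)) := by
        field_simp
      rw [this]
      refine div_nonneg ?_ (by positivity)
      nlinarith [mul_nonneg (sub_nonneg.2 h5) (sub_nonneg.2 h5),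
        mul_nonneg (mul_nonneg (sub_nonneg.2 h5) (sub_nonneg.2 h5)) (sub_nonneg.2 h5)]
    linarith
  rw [Finset.sum_add_distrib, ← Finset.mul_sum] at h3
  have h4 := hsm.sum_le_tsum ((z + 1).primesBelow.erase 2) fun n _ => by positivity
  norm_num at h2
  linarith

/-- Terms in `[0, 1]` can be selected so that their sum is close to a given target. -/
lemma exists_subset_sum_near {ι : Type*} (A : Finset ι) (f : ι → ℝ) (hf : ∀ i ∈ A, f i ≤ 1)
    {t : ℝ} (ht : t ≤ ∑ i ∈ A, f i) :
    ∃ P ⊆ A, t ≤ ∑ i ∈ P, f i ∧ ∑ i ∈ P, f i ≤ max t 0 + 1 := by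
  classical
  induction A using Finset.induction_on with
  | empty => exact ⟨∅, subset_rfl, ht, by simp; positivity⟩
  | insert a A ha ih =>
    by_cases h : t ≤ ∑ i ∈ A, f i
    · obtain ⟨P, hP, h1⟩ := ih (fun i hi => hf i (Finset.mem_insert_of_mem hi)) h
      exact ⟨P, hP.trans (Finset.subset_insert _ _), h1⟩
    · refine ⟨insert a A, subset_rfl, ht, ?_⟩
      rw [Finset.sum_insert ha]
      linarith [hf a (Finset.mem_insert_self _ _), le_max_left t 0, not_le.1 h]

/-- The quadruples of integers bounded by `X` whose curve is everywhere locally soluble. -/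
def locallySolubleQuadruples (X : ℝ) : Set (ℤ × ℤ × ℤ × ℤ) :=
  {q | (|q.1| : ℝ) ≤ X ∧ (|q.2.1| : ℝ) ≤ X ∧ (|q.2.2.1| : ℝ) ≤ X ∧ (|q.2.2.2| : ℝ) ≤ X ∧
    q.1 * q.2.2.2 - q.2.1 * q.2.2.1 ≠ 0 ∧
    HasPoint ℝ q.1 q.2.1 q.2.2.1 q.2.2.2 ∧
    ∀ (p : ℕ) [Fact p.Prime], HasPoint ℚ_[p] q.1 q.2.1 q.2.2.1 q.2.2.2}

lemma ncard_locallySolubleQuadruples_le_card_filter {X : ℝ}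
    (R : (Fin 4 → ℤ) → Prop) [DecidablePred R]
    (hR : ∀ v : Fin 4 → ℤ, (∀ (p : ℕ) [Fact p.Prime],
      HasPoint ℚ_[p] (v 0) (v 1) (v 2) (v 3)) → R v) :
    (locallySolubleQuadruples X).ncard ≤ ((integerBox ⌊X⌋₊).filter R).card := by
  rw [← Set.ncard_coe_finset]
  refine Set.ncard_le_ncard_of_injOn (fun q => ![q.1, q.2.1, q.2.2.1, q.2.2.2]) ?_ ?_
    (Finset.finite_toSet _)
  · rintro ⟨a, b, c, d⟩ ⟨ha, hb, hc, hd, -, -, h⟩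
    have key : ∀ n : ℤ, |(n : ℝ)| ≤ X → n ∈ Finset.Ico (-(⌊X⌋₊ : ℤ)) (⌊X⌋₊ + 1) := by
      intro n hn
      have h1 : n.natAbs ≤ ⌊X⌋₊ := Nat.le_floor (by rwa [Nat.cast_natAbs, Int.cast_abs])
      rw [Finset.mem_Ico]
      omega
    simp only [Finset.coe_filter, Set.mem_ofPred_eq, integerBox, Fintype.mem_piFinset]
    refine ⟨fun i => ?_, hR _ h⟩
    fin_cases i
    exacts [key a ha, key b hb, key c hc, key d hd]
  · rintro ⟨a, b, c, d⟩ - ⟨a', b', c', d'⟩ - h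
    have h0 := congrFun h 0
    have h1 := congrFun h 1
    have h2 := congrFun h 2
    have h3 := congrFun h 3
    simp at h0 h1 h2 h3
    simp [h0, h1, h2, h3]

lemma two_mul_floor_add_one_le {X : ℝ} (hX : 1 ≤ X) : (2 * ⌊X⌋₊ + 1 : ℝ) ≤ 3 * X := by
  linarith [Nat.floor_le (zero_le_one.trans hX)]

lemma ncard_locallySolubleQuadruples_le {X : ℝ} (hX : 1 ≤ X) :
    ((locallySolubleQuadruples X).ncard : ℝ) ≤ 81 * X ^ 4 := by
  have h := ncard_locallySolubleQuadruples_le_card_filter (X := X) (fun _ => True)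
    (fun _ _ => trivial)
  have h2 : ((Finset.filter (fun _ => True) (integerBox ⌊X⌋₊)).card : ℝ) =
      (2 * ⌊X⌋₊ + 1 : ℝ) ^ 4 := by
    have h3 : ((⌊X⌋₊ : ℤ) + 1 - -(⌊X⌋₊ : ℤ)).toNat = 2 * ⌊X⌋₊ + 1 := by omega
    rw [Finset.filter_true, integerBox, Fintype.card_piFinset]
    simp only [Int.card_Ico, h3, Finset.prod_const, Finset.card_univ, Fintype.card_fin]
    push_cast
    rfl
  calc ((locallySolubleQuadruples X).ncard : ℝ) ≤ (2 * ⌊X⌋₊ + 1 : ℝ) ^ 4 := by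
        rw [← h2]; exact_mod_cast h
    _ ≤ (3 * X) ^ 4 := by gcongr; exact two_mul_floor_add_one_le hX
    _ = 81 * X ^ 4 := by ring

lemma one_le_log_log {X : ℝ} (hX : 16 ≤ X) : 1 ≤ Real.log (Real.log X) := by
  have h1 : Real.exp 1 ≤ Real.log X := by
    have h2 : Real.log 16 ≤ Real.log X := Real.log_le_log (by norm_num) hX
    have h3 : Real.log 16 = 4 * Real.log 2 := by
      rw [show (16 : ℝ) = 2 ^ 4 by norm_num, Real.log_pow]; norm_num
    linarith [Real.log_two_gt_d9, Real.exp_one_lt_d9]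
  exact (Real.le_log_iff_exp_le ((Real.exp_pos 1).trans_le h1)).2 h1

/-- The sieve bound, for `X` so large that `32 log log X ≤ log X`. -/
lemma exists_ncard_locallySolubleQuadruples_le : ∃ C : ℝ, 0 ≤ C ∧ ∀ X : ℝ, 16 ≤ X →
    32 * Real.log (Real.log X) ≤ Real.log X →
    ((locallySolubleQuadruples X).ncard : ℝ) ≤
      C * X ^ 4 * (Real.log (Real.log X) ^ ((1 : ℝ) / 4) / Real.log X ^ ((1 : ℝ) / 4)) := by
  classical
  choose Ω hΩ using exists_obstructing_residues
  obtain ⟨C₀, hC₀, hsum⟩ := exists_log_log_le_sum_density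
  refine ⟨81 * (Real.exp C₀ * 32 ^ ((1 : ℝ) / 4) + Real.exp 3) + 1215, by positivity,
    fun X hX hlarge => ?_⟩
  have hl := one_le_log_log hX
  have hX0 : 0 < X := by linarith
  have hL : 0 < Real.log X := by linarith
  set L := Real.log X with hLdef
  set l := Real.log L with hldef
  set G := l ^ ((1 : ℝ) / 4) / L ^ ((1 : ℝ) / 4) with hG
  have hexpl : Real.exp l = L := Real.exp_log hL
  have hexpL : Real.exp L = X := Real.exp_log hX0
  have hGl : Real.exp (-(l / 4)) ≤ G := by
    have h1 : Real.exp (-(l / 4)) = 1 / L ^ ((1 : ℝ) / 4) := by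
      rw [Real.rpow_def_of_pos hL, Real.exp_neg, one_div, ← hldef]
      congr 2
      ring
    rw [h1, hG]
    gcongr
    exact Real.one_le_rpow hl (by norm_num)
  set y := L / (16 * l) with hy
  have hy2 : 2 ≤ y := by
    rw [hy, le_div_iff₀ (by positivity)]
    linarith
  set z := ⌊Real.exp y⌋₊ with hz
  have hzle : (z : ℝ) ≤ Real.exp y := Nat.floor_le (Real.exp_pos _).le
  have hylow : Real.exp (y / 2) ≤ z := by
    have h1 : Real.exp y < z + 1 := Nat.lt_floor_add_one _
    have h2 : Real.exp y = Real.exp (y / 2) * Real.exp (y / 2) := by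
      rw [← Real.exp_add]; ring_nf
    have h3 : y / 2 + 1 ≤ Real.exp (y / 2) := Real.add_one_le_exp _
    nlinarith
  have hz2 : 2 ≤ z := by
    have h3 : y / 2 + 1 ≤ Real.exp (y / 2) := Real.add_one_le_exp _
    have : (2 : ℝ) ≤ z := by linarith
    exact_mod_cast this
  have hzpos : (0 : ℝ) < z := by positivity
  have hlogz : y / 2 ≤ Real.log z := (Real.le_log_iff_exp_le hzpos).2 hylow
  have hlogz' : Real.log z ≤ L := by
    have h1 : Real.log z ≤ y := (Real.log_le_iff_le_exp hzpos).2 hzle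
    have h2 : y ≤ L := div_le_self hL.le (by linarith)
    linarith
  have hloglog : Real.log (y / 2) ≤ Real.log (Real.log z) :=
    Real.log_le_log (by linarith) hlogz
  have hloglog' : Real.log (Real.log z) ≤ l := Real.log_le_log (by linarith) hlogz'
  have hdens := hsum (fun p => (Ω p).card / (p : ℝ) ^ 4) (fun p hp hp2 => by
    have : Fact p.Prime := ⟨hp⟩
    have := (hΩ p hp2).1
    gcongr) z hz2
  obtain ⟨P, hPsub, hs1, hs2⟩ := exists_subset_sum_near _ _ (fun p hp => by
    have : NeZero p := ⟨(Nat.prime_of_mem_primesBelow (Finset.mem_of_mem_erase hp)).ne_zero⟩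
    have h6 := Finset.card_le_univ (Ω p)
    rw [Fintype.card_fun, ZMod.card, Fintype.card_fin] at h6
    exact div_le_one_of_le₀ (by exact_mod_cast h6) (by positivity)) hdens
  have hPprime : ∀ p ∈ P, p.Prime := fun p hp =>
    Nat.prime_of_mem_primesBelow (Finset.mem_of_mem_erase (hPsub hp))
  have hPz : ∀ p ∈ P, p ≤ z := fun p hp =>
    Nat.lt_succ_iff.1 (Nat.lt_of_mem_primesBelow (Finset.mem_of_mem_erase (hPsub hp)))
  have hP2 : ∀ p ∈ P, p ≠ 2 := fun p hp => Finset.ne_of_mem_erase (hPsub hp)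
  set s := ∑ p ∈ P, ((Ω p).card / (p : ℝ) ^ 4) with hs
  set r := 2 * ⌈l⌉₊ with hr
  have hr1 : 2 * l ≤ r := by
    rw [hr]; push_cast; linarith [Nat.le_ceil l]
  have hr2 : (r : ℝ) ≤ 4 * l := by
    rw [hr]; push_cast; linarith [Nat.ceil_lt_add_one (zero_le_one.trans hl)]
  have hzr : ((z : ℝ) ^ r) ^ 2 ≤ Real.exp (L / 2) := by
    rw [← pow_mul]
    calc (z : ℝ) ^ (r * 2) ≤ Real.exp y ^ (r * 2) := by gcongr
      _ = Real.exp ((r * 2 : ℕ) * y) := (Real.exp_nat_mul _ _).symm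
      _ ≤ Real.exp (L / 2) := by
        gcongr
        push_cast
        calc r * 2 * y ≤ 4 * l * 2 * y := by gcongr
          _ = L / 2 := by rw [hy]; field_simp; norm_num
  have hzr1 : 1 ≤ (z : ℝ) ^ r := one_le_pow₀ (by exact_mod_cast (by omega : 1 ≤ z))
  have hfloor : X < ⌊X⌋₊ + 1 := Nat.lt_floor_add_one X
  have hN : z ^ r ≤ 2 * ⌊X⌋₊ + 1 := by
    have h1 : (z : ℝ) ^ r ≤ 2 * ⌊X⌋₊ + 1 := by
      have h2 : Real.exp (L / 2) ≤ X := by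
        rw [← hexpL]; gcongr; linarith
      have h3 : (1 : ℝ) ≤ ⌊X⌋₊ := by linarith
      nlinarith
    exact_mod_cast h1
  have hmain := card_sifted_integerBox_le hPprime Ω (by omega) hPz (even_two_mul _) hN
  rw [← hs] at hmain
  have hcount := ncard_locallySolubleQuadruples_le_card_filter (X := X)
    (fun v => ∀ p ∈ P, (fun i => (v i : ZMod p)) ∉ Ω p) (fun v hv p hp hmem => by
      have : Fact p.Prime := ⟨hPprime p hp⟩
      exact (hΩ p (hP2 p hp)).2 v hmem (hv p))
  have hM := two_mul_floor_add_one_le (show 1 ≤ X by linarith)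
  have hE1 : Real.exp (-s) ≤ Real.exp C₀ * 32 ^ ((1 : ℝ) / 4) * G := by
    have h1 : Real.exp (-s) ≤ Real.exp (C₀ + -(Real.log (y / 2) / 4)) := by
      gcongr; linarith
    refine h1.trans (le_of_eq ?_)
    rw [Real.exp_add, mul_assoc]
    congr 1
    have h2 : y / 2 = L / (32 * l) := by rw [hy]; field_simp; norm_num
    have hl0 : 0 < l := by linarith
    rw [h2, hG, ← mul_div_assoc, ← Real.mul_rpow (by norm_num) hl0.le,
      ← Real.div_rpow (by positivity) hL.le, Real.rpow_def_of_pos (by positivity),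
      ← inv_div L (32 * l), Real.log_inv]
    congr 1
    ring
  have hE2 : Real.exp (3 * s - r) ≤ Real.exp 3 * G := by
    have h1 : max (Real.log (Real.log z) / 4 - C₀) 0 ≤ l / 4 :=
      max_le (by linarith) (by linarith)
    calc Real.exp (3 * s - r) ≤ Real.exp (3 + -(l / 4)) := by
          gcongr; linarith
      _ = Real.exp 3 * Real.exp (-(l / 4)) := Real.exp_add _ _
      _ ≤ _ := by gcongr
  have hE3 : Real.exp (L / 2) ≤ X * G := by
    calc Real.exp (L / 2) ≤ Real.exp (L + -(l / 4)) := by gcongr; linarith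
      _ = X * Real.exp (-(l / 4)) := by rw [Real.exp_add, hexpL]
      _ ≤ _ := by gcongr
  calc ((locallySolubleQuadruples X).ncard : ℝ)
      ≤ _ := by exact_mod_cast hcount
    _ ≤ _ := hmain
    _ ≤ (3 * X) ^ 4 * (Real.exp C₀ * 32 ^ ((1 : ℝ) / 4) * G + Real.exp 3 * G) +
        45 * (3 * X) ^ 3 * (X * G) := by
      have h5 : (z : ℝ) ^ (2 * r) ≤ X * G := by
        rw [mul_comm, pow_mul]; exact hzr.trans hE3
      gcongr
    _ = _ := by ring

theorem stmt_0 : ∃ C : ℝ, 0 < C ∧ ∀ X : ℝ, 16 ≤ X →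
    (Set.ncard {q : ℤ × ℤ × ℤ × ℤ |
        (|q.1| : ℝ) ≤ X ∧ (|q.2.1| : ℝ) ≤ X ∧ (|q.2.2.1| : ℝ) ≤ X ∧ (|q.2.2.2| : ℝ) ≤ X ∧
        q.1 * q.2.2.2 - q.2.1 * q.2.2.1 ≠ 0 ∧
        HasPoint ℝ q.1 q.2.1 q.2.2.1 q.2.2.2 ∧
        ∀ (p : ℕ) [Fact p.Prime], HasPoint ℚ_[p] q.1 q.2.1 q.2.2.1 q.2.2.2} : ℝ)
      ≤ C * X ^ 4 * Real.log (Real.log X) ^ ((7 : ℝ) / 3) / Real.log X ^ ((1 : ℝ) / 4) := by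
  obtain ⟨C, hC, hbound⟩ := exists_ncard_locallySolubleQuadruples_le
  have hev : ∀ᶠ t in Filter.atTop, 32 * Real.log t ≤ t := by
    filter_upwards [Real.isLittleO_log_id_atTop.bound (show (0 : ℝ) < 1 / 32 by norm_num),
      Filter.eventually_ge_atTop 0] with t ht ht0
    simp only [id, Real.norm_eq_abs, abs_of_nonneg ht0] at ht
    linarith [le_abs_self (Real.log t)]
  obtain ⟨L₀, hL₀⟩ := Filter.eventually_atTop.1 hev
  refine ⟨C + 81 * max L₀ 1 ^ ((1 : ℝ) / 4), by positivity, fun X hX => ?_⟩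
  change ((locallySolubleQuadruples X).ncard : ℝ) ≤ _
  have hl := one_le_log_log hX
  have hX0 : 0 < X := by linarith
  have hL : 0 < Real.log X := Real.log_pos (by linarith)
  rw [mul_div_assoc]
  rcases le_total L₀ (Real.log X) with h | h
  · refine (hbound X hX (hL₀ _ h)).trans ?_
    gcongr
    · linarith [show 0 ≤ 81 * max L₀ 1 ^ ((1 : ℝ) / 4) by positivity]
    · norm_num
    · norm_num
  · refine (ncard_locallySolubleQuadruples_le (by linarith)).trans ?_
    have h1 : 1 ≤ Real.log (Real.log X) ^ ((7 : ℝ) / 3) := Real.one_le_rpow hl (by norm_num)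
    have h2 : Real.log X ^ ((1 : ℝ) / 4) ≤ max L₀ 1 ^ ((1 : ℝ) / 4) := by
      gcongr
      exact h.trans (le_max_left _ _)
    have h3 : (max L₀ 1 ^ ((1 : ℝ) / 4))⁻¹ ≤
        Real.log (Real.log X) ^ ((7 : ℝ) / 3) / Real.log X ^ ((1 : ℝ) / 4) := by
      rw [inv_eq_one_div]
      gcongr
    calc 81 * X ^ 4 = 81 * max L₀ 1 ^ ((1 : ℝ) / 4) * X ^ 4 * (max L₀ 1 ^ ((1 : ℝ) / 4))⁻¹ := by
          field_simp
      _ ≤ _ := by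
          gcongr
          linarith
end

section
/- For every t ∈ ℚ with t ∉ {−1, 0, 1}, the set of points P on the line L_t = {(x, (2t/(1−t²))·x) : x ∈ ℝ} ⊆ ℝ² such that the Euclidean distances from P to (0,0), to (0,1), and to (1,1) are all rational numbers is dense in L_t (in the subspace topology). Moreover, the set of points P on the line {(0, y) : y ∈ ℝ} whose Euclidean distances to (0,0), (0,1), and (1,1) are all rational is dense in that line. -/
/-- The Euclidean distance between two points of `ℝ × ℝ`. -/
noncomputable def euclDist (P Q : ℝ × ℝ) : ℝ :=
  Real.sqrt ((P.1 - Q.1) ^ 2 + (P.2 - Q.2) ^ 2)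

/-- `P` has rational Euclidean distance to each of `(0,0)`, `(0,1)` and `(1,1)`. -/
def RatDists (P : ℝ × ℝ) : Prop :=
  (∃ q : ℚ, euclDist P (0, 0) = q) ∧ (∃ q : ℚ, euclDist P (0, 1) = q) ∧
    ∃ q : ℚ, euclDist P (1, 1) = q

/-- The cubic curve `(1 - 2x - x²) y = n x (1 - y²)`, that is `1/x - x - 2 = n (1/y - y)`. -/
def OnCubic {K : Type*} [Field K] (n x y : K) : Prop :=
  (1 - 2 * x - x ^ 2) * y = n * x * (1 - y ^ 2)

namespace OnCubic

variable {K : Type*} [Field K] {n x y : K}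

theorem neg_inv_right (h : OnCubic n x y) (hy : y ≠ 0) : OnCubic n x (-y⁻¹) := by
  unfold OnCubic at *
  field_simp
  linear_combination (-1) * h

theorem neg_inv_left (h : OnCubic n x y) (hx : x ≠ 0) (hy : y ≠ 0) : OnCubic n (-x⁻¹) (-y⁻¹) := by
  unfold OnCubic at *
  field_simp
  linear_combination h

theorem neg_neg (h : OnCubic n x y) : OnCubic (-n) x (-y) := by
  unfold OnCubic at *
  linear_combination (-1) * h

theorem right_ne_zero (h : OnCubic n x y) (hn : n ≠ 0) (hx : x ≠ 0) : y ≠ 0 := by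
  rintro rfl
  simp [OnCubic, hn, hx] at h

/-- The third intersection point of a chord with the cubic. -/
theorem chord {x₁ y₁ x₂ y₂ l : K} (h₁ : OnCubic n x₁ y₁) (h₂ : OnCubic n x₂ y₂)
    (hl : (x₂ - x₁) * (y₂ - y₁) * (n * (y₂ - y₁) - (x₂ - x₁)) * (l + 1) =
      2 * (x₂ - x₁) * (y₂ - y₁) + (x₂ - x₁) ^ 2 * y₁ + 2 * x₁ * (x₂ - x₁) * (y₂ - y₁)
        - n * x₁ * (y₂ - y₁) ^ 2 - 2 * n * y₁ * (x₂ - x₁) * (y₂ - y₁)) :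
    OnCubic n (x₁ + l * (x₂ - x₁)) (y₁ + l * (y₂ - y₁)) := by
  unfold OnCubic at *
  linear_combination (1 - l) * h₁ + l * h₂ + l * (l - 1) * hl

/-- The duplication formula. -/
theorem double (h : OnCubic n x y) (hn : n ≠ 0) (hx : x ≠ 0) (hy : y ≠ 0) (hx' : 1 + x ^ 2 ≠ 0)
    (hy' : 1 + y ^ 2 ≠ 0) (hy'' : 1 - y ^ 2 ≠ 0) (hxy : 1 - x ^ 2 * y ^ 2 ≠ 0) :
    ∃ z, OnCubic n
      (2 * x ^ 2 * (1 + y ^ 2) * (n / y + 1 + x) / ((1 + x ^ 2) * (1 - x ^ 2 * y ^ 2))) z := by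
  refine ⟨2 * y ^ 2 * (1 + x ^ 2) ^ 2 * (n / y + 1 + x) /
    (n * (1 + y ^ 2) * (1 + x ^ 2) * (1 - x ^ 2 * y ^ 2)), ?_⟩
  unfold OnCubic at *
  have hn' : n = (1 - 2 * x - x ^ 2) * y / (x * (1 - y ^ 2)) := by
    field_simp
    linear_combination -h
  have hq : 1 - 2 * x - x ^ 2 ≠ 0 := by
    intro h0
    apply hn
    rw [hn', h0]; simp
  subst hn'
  have e : (1 - 2 * x - x ^ 2) * y / (x * (1 - y ^ 2)) / y + 1 + x =
     (1 - x - x * y ^ 2 - x ^ 2 * y ^ 2) / (x * (1 - y ^ 2)) := by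
    field_simp
    ring
  rw [e]
  field_simp
  ring

/-- The difference of two points on the identity component, in terms of the slopes
`m₁ = y₁ / x₁` and `m₂ = y₂ / x₂`. -/
theorem sub {x₁ m₁ x₂ m₂ : K} (h₁ : OnCubic n x₁ (x₁ * m₁)) (h₂ : OnCubic n x₂ (x₂ * m₂))
    (hx₂ : x₂ ≠ 0) (hm₂ : m₂ ≠ 0) (hne : x₁ ≠ x₂) (hd₁ : 1 + x₁ * m₁ * (x₂ * m₂) ≠ 0)
    (hd₂ : n * (1 + x₁ * m₁ * (x₂ * m₂)) + (x₂ - x₁) * (x₂ * m₂) ≠ 0) :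
    ∃ z, OnCubic n ((x₂ - x₁) * ((x₂ - x₁) * (x₁ * m₁) * (x₂ * m₂) ^ 2
        - (1 + x₁ * m₁ * (x₂ * m₂)) * (m₂ + n * (x₂ * m₂) * (x₂ * m₂ - x₁ * m₁)))
      / ((1 + x₁ * m₁ * (x₂ * m₂)) *
        (n * (1 + x₁ * m₁ * (x₂ * m₂)) + (x₂ - x₁) * (x₂ * m₂)))) z := by
  set y₁ := x₁ * m₁ with hy₁
  set y₂ := x₂ * m₂ with hy₂
  have hy₂_ne : y₂ ≠ 0 := mul_ne_zero hx₂ hm₂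
  have hm : m₂ = y₂ / x₂ := by rw [hy₂]; field_simp
  set w := -y₂⁻¹ with hw
  have h₃ : OnCubic n x₂ w := h₂.neg_inv_right hy₂_ne
  have ha : x₂ - x₁ ≠ 0 := sub_ne_zero.2 hne.symm
  have hb : w - y₁ = -(1 + y₁ * y₂) / y₂ := by rw [hw]; field_simp; ring
  have hc : n * (w - y₁) - (x₂ - x₁) = -(n * (1 + y₁ * y₂) + (x₂ - x₁) * y₂) / y₂ := by
    rw [hb]; field_simp; ring
  have hb0 : w - y₁ ≠ 0 := by rw [hb]; exact div_ne_zero (neg_ne_zero.2 hd₁) hy₂_ne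
  have hc0 : n * (w - y₁) - (x₂ - x₁) ≠ 0 := by
    rw [hc]; exact div_ne_zero (neg_ne_zero.2 hd₂) hy₂_ne
  obtain ⟨l, hl⟩ : ∃ l, (x₂ - x₁) * (w - y₁) * (n * (w - y₁) - (x₂ - x₁)) * (l + 1) =
      2 * (x₂ - x₁) * (w - y₁) + (x₂ - x₁) ^ 2 * y₁ + 2 * x₁ * (x₂ - x₁) * (w - y₁)
        - n * x₁ * (w - y₁) ^ 2 - 2 * n * y₁ * (x₂ - x₁) * (w - y₁) := by
    refine ⟨(2 * (x₂ - x₁) * (w - y₁) + (x₂ - x₁) ^ 2 * y₁ + 2 * x₁ * (x₂ - x₁) * (w - y₁)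
        - n * x₁ * (w - y₁) ^ 2 - 2 * n * y₁ * (x₂ - x₁) * (w - y₁)) /
        ((x₂ - x₁) * (w - y₁) * (n * (w - y₁) - (x₂ - x₁))) - 1, ?_⟩
    rw [sub_add_cancel, mul_div_cancel₀ _ (mul_ne_zero (mul_ne_zero ha hb0) hc0)]
  refine ⟨_, (congrArg (OnCubic n · (y₁ + l * (w - y₁))) ?_).mp (chord h₁ h₃ hl)⟩
  have key : (x₁ + l * (x₂ - x₁)) * ((w - y₁) * (n * (w - y₁) - (x₂ - x₁))) =
      (x₂ - x₁) * ((w - y₁) * (x₂ + 2 - n * w - n * y₁) + (x₂ - x₁) * y₁) := by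
    linear_combination hl
  have hrel : x₂ + 2 - n * w = 1 / x₂ + n * y₂ := by
    unfold OnCubic at h₂
    rw [hw]
    field_simp
    linear_combination -h₂
  rw [hrel, hc, hb] at key
  rw [eq_div_iff (mul_ne_zero hd₁ hd₂), hm]
  field_simp at key ⊢
  linear_combination key

end OnCubic

section TwoAdic

/-- The `2`-adic absolute value on `ℚ`. -/
local notation "nrm" => padicNorm 2

theorem padicNorm_two_two : nrm 2 = 1 / 2 := by
  have := padicNorm.padicNorm_p_of_prime (p := 2)
  norm_num at this ⊢
  exact this

theorem padicNorm_add_eq_left {p : ℕ} [Fact p.Prime] {a b : ℚ}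
    (h : padicNorm p b < padicNorm p a) : padicNorm p (a + b) = padicNorm p a := by
  rw [padicNorm.add_eq_max_of_ne h.ne', max_eq_left h.le]

theorem padicNorm_sub_eq_left {p : ℕ} [Fact p.Prime] {a b : ℚ}
    (h : padicNorm p b < padicNorm p a) : padicNorm p (a - b) = padicNorm p a := by
  rw [sub_eq_add_neg, padicNorm_add_eq_left (by rwa [padicNorm.neg])]

theorem padicNorm_mul_lt_one {p : ℕ} [Fact p.Prime] {a b : ℚ}
    (ha : padicNorm p a < 1) (hb : padicNorm p b ≤ 1) : padicNorm p (a * b) < 1 := by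
  rw [padicNorm.mul]
  exact (mul_le_of_le_one_right (padicNorm.nonneg _) hb).trans_lt ha

theorem padicNorm_pow_lt_one {p : ℕ} [Fact p.Prime] {a : ℚ} (ha : padicNorm p a < 1) :
    padicNorm p (a ^ 2) < 1 := by
  rw [pow_two]
  exact padicNorm_mul_lt_one ha ha.le

theorem padicNorm_one_add {p : ℕ} [Fact p.Prime] {a : ℚ} (ha : padicNorm p a < 1) :
    padicNorm p (1 + a) = 1 := by
  rw [padicNorm_add_eq_left (by simpa using ha), padicNorm.one]

theorem padicNorm_one_sub {p : ℕ} [Fact p.Prime] {a : ℚ} (ha : padicNorm p a < 1) :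
    padicNorm p (1 - a) = 1 := by
  rw [padicNorm_sub_eq_left (by simpa using ha), padicNorm.one]

theorem padicNorm_one_sub_two_mul_sub_sq {x : ℚ} (hx : nrm x < 1) :
    nrm (1 - 2 * x - x ^ 2) = 1 := by
  have h : 1 - 2 * x - x ^ 2 = 1 - x * (2 + x) := by ring
  rw [h]
  refine padicNorm_one_sub (padicNorm_mul_lt_one hx ?_)
  refine padicNorm.nonarchimedean.trans (max_le ?_ hx.le)
  rw [padicNorm_two_two]; norm_num

/-- Rational points of the cubic that are `2`-adically close to the origin. -/
def nearOrigin (n : ℚ) : Set ℚ :=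
  {x | x ≠ 0 ∧ nrm x < 1 ∧ nrm (n * x) < 1 ∧ ∃ y, OnCubic n x y}

theorem OnCubic.exists_padicNorm_lt_one {n x y : ℚ} (h : OnCubic n x y) (hn : n ≠ 0) (hx0 : x ≠ 0)
    (hx : nrm x < 1) (hnx : nrm (n * x) < 1) : ∃ z, OnCubic n x z ∧ z ≠ 0 ∧ nrm z < 1 := by
  have hy : y ≠ 0 := h.right_ne_zero hn hx0
  rcases lt_trichotomy (nrm y) 1 with hlt | heq | hgt
  · exact ⟨y, h, hy, hlt⟩
  · exfalso
    have e := congrArg nrm h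
    rw [padicNorm.mul, padicNorm_one_sub_two_mul_sub_sq hx, heq, one_mul] at e
    refine (padicNorm_mul_lt_one hnx ?_).ne e.symm
    refine padicNorm.sub.trans (max_le (by simp) ?_)
    rw [pow_two, padicNorm.mul, heq, one_mul]
  · refine ⟨-y⁻¹, h.neg_inv_right hy, by simpa using hy, ?_⟩
    rw [padicNorm.neg, ← one_div, padicNorm.div, padicNorm.one, one_div]
    exact inv_lt_one_of_one_lt₀ hgt

theorem nearOrigin.exists_padicNorm_lt {n x : ℚ} (hn : n ≠ 0) (h : x ∈ nearOrigin n) :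
    ∃ x' ∈ nearOrigin n, nrm x' < nrm x := by
  obtain ⟨hx0, hx, hnx, y₀, hy₀⟩ := h
  obtain ⟨y, h, hy0, hy⟩ := hy₀.exists_padicNorm_lt_one hn hx0 hx hnx
  have hpos : 0 < nrm x := lt_of_le_of_ne (padicNorm.nonneg _) (padicNorm.nonzero hx0).symm
  have hx2 := padicNorm_pow_lt_one hx
  have hy2 := padicNorm_pow_lt_one hy
  have e₁ := padicNorm_one_add hx2
  have e₂ := padicNorm_one_add hy2
  have e₃ := padicNorm_one_sub hy2
  have e₄ := padicNorm_one_sub (padicNorm_mul_lt_one hx2 hy2.le)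
  have ne_of {a : ℚ} (ha : nrm a = 1) : a ≠ 0 := by
    rintro rfl
    simp at ha
  have hyn : nrm y = nrm n * nrm x := by
    have e := congrArg nrm h
    rwa [padicNorm.mul, padicNorm_one_sub_two_mul_sub_sq hx, padicNorm.mul, e₃, one_mul, mul_one,
      padicNorm.mul] at e
  have e₅ : nrm (n / y + 1 + x) = (nrm x)⁻¹ := by
    have hny : nrm (n / y) = (nrm x)⁻¹ := by
      rw [padicNorm.div, hyn]
      have := padicNorm.nonzero (p := 2) hn
      field_simp
    rw [add_assoc, padicNorm_add_eq_left, hny]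
    rw [hny, padicNorm_one_add hx]
    exact (one_lt_inv₀ hpos).2 hx
  obtain ⟨z, hz⟩ := h.double hn hx0 hy0 (ne_of e₁) (ne_of e₂) (ne_of e₃) (ne_of e₄)
  set x' := 2 * x ^ 2 * (1 + y ^ 2) * (n / y + 1 + x) / ((1 + x ^ 2) * (1 - x ^ 2 * y ^ 2))
  have hx' : nrm x' = nrm x / 2 := by
    have hsq : nrm (x ^ 2) = nrm x ^ 2 := by rw [pow_two, padicNorm.mul, pow_two]
    simp only [x', padicNorm.div, padicNorm.mul, e₁, e₂, e₄, e₅, padicNorm_two_two, hsq]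
    field_simp
  have hlt : nrm x' < nrm x := by rw [hx']; linarith
  refine ⟨x', ⟨?_, hlt.trans hx, ?_, z, hz⟩, hlt⟩
  · intro h0
    rw [h0, padicNorm.zero] at hx'
    linarith
  · rw [padicNorm.mul] at hnx ⊢
    exact (mul_le_mul_of_nonneg_left hlt.le (padicNorm.nonneg _)).trans_lt hnx

theorem nearOrigin.infinite {n : ℚ} (hn : n ≠ 0) (h : (nearOrigin n).Nonempty) :
    (nearOrigin n).Infinite := by
  intro hfin
  obtain ⟨x, hx, hmin⟩ := Set.exists_min_image _ nrm hfin h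
  obtain ⟨x', hx', hlt⟩ := nearOrigin.exists_padicNorm_lt hn hx
  exact (hmin x' hx').not_gt hlt

theorem padicNorm_two_one_sub_sq_le {t : ℚ} (ht : nrm t = 1) : nrm (1 - t ^ 2) ≤ 1 / 4 := by
  have hnum : ¬ (2 : ℤ) ∣ t.num := by
    intro hd
    have hden : ¬ (2 : ℤ) ∣ t.den := fun hd' ↦ by
      have := Int.dvd_gcd hd hd'
      rw [Int.gcd_eq_natAbs, Int.natAbs_natCast, t.reduced] at this
      norm_num at this
    have h₁ : nrm (t.den : ℤ) = 1 := (padicNorm.int_eq_one_iff _).2 hden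
    have h₂ : nrm t.num < 1 := (padicNorm.int_lt_one_iff _).2 hd
    rw [← t.num_div_den, padicNorm.div] at ht
    push_cast at h₁
    rw [h₁, div_one] at ht
    exact h₂.ne ht
  have hden' : nrm (t.den : ℤ) = 1 := by
    have h₂ : nrm t.num = 1 := (padicNorm.int_eq_one_iff _).2 hnum
    rw [← t.num_div_den, padicNorm.div, h₂] at ht
    push_cast
    rw [one_div, inv_eq_one] at ht
    exact ht
  have hden : ¬ (2 : ℤ) ∣ t.den := (padicNorm.int_eq_one_iff _).1 hden'
  have h4 : ((2 ^ 2 : ℕ) : ℤ) ∣ (t.den ^ 2 - t.num ^ 2) := by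
    have := (Int.sq_mod_four_eq_one_of_odd (Int.not_even_iff_odd.1 fun h ↦ hnum h.two_dvd))
    have := (Int.sq_mod_four_eq_one_of_odd (Int.not_even_iff_odd.1 fun h ↦ hden h.two_dvd))
    norm_num
    omega
  have h := padicNorm.dvd_iff_norm_le.1 h4
  have hd0 : (t.den : ℚ) ≠ 0 := by exact_mod_cast t.den_nz
  have e : 1 - t ^ 2 = ((t.den ^ 2 - t.num ^ 2 : ℤ) : ℚ) / ((t.den : ℤ) : ℚ) ^ 2 := by
    push_cast
    nth_rw 1 [← t.num_div_den]
    field_simp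
  rw [e, padicNorm.div, pow_two (((t.den : ℤ) : ℚ)), padicNorm.mul, hden']
  norm_num at h ⊢
  exact h

theorem one_sub_sq_ne_zero {t : ℚ} (h₁ : t ≠ -1) (h₁' : t ≠ 1) : 1 - t ^ 2 ≠ 0 := by
  have : 1 - t ^ 2 = (1 - t) * (1 + t) := by ring
  rw [this]
  exact mul_ne_zero (sub_ne_zero.2 h₁'.symm) (fun h ↦ h₁ (by linarith))

theorem nearOrigin_nonempty {t : ℚ} (h₁ : t ≠ -1) (h₀ : t ≠ 0) (h₁' : t ≠ 1) :
    2 * t / (1 - t ^ 2) - 1 ≠ 0 ∧ (nearOrigin (2 * t / (1 - t ^ 2) - 1)).Nonempty := by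
  have ht := one_sub_sq_ne_zero h₁ h₁'
  have hseed (n : ℚ) (hn : n ^ 2 - 1 ≠ 0) : OnCubic n (2 / (n ^ 2 - 1)) (2 * n / (n ^ 2 - 1)) := by
    unfold OnCubic
    field_simp
    ring
  set m := 2 * t / (1 - t ^ 2) with hm
  have hm0 : m ≠ 0 := div_ne_zero (mul_ne_zero two_ne_zero h₀) ht
  have hmn : nrm m = nrm t / 2 / nrm (1 - t ^ 2) := by
    rw [hm, padicNorm.div, padicNorm.mul, padicNorm_two_two]
    ring
  have hpos : 0 < nrm (1 - t ^ 2) :=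
    lt_of_le_of_ne (padicNorm.nonneg _) (padicNorm.nonzero ht).symm
  have ne_of {a : ℚ} (ha : 0 < nrm a) : a ≠ 0 := by
    rintro rfl
    simp at ha
  by_cases hcase : nrm t = 1
  · have hm1 : 1 < nrm m := by
      rw [hmn, hcase, lt_div_iff₀ hpos]
      have := padicNorm_two_one_sub_sq_le hcase
      linarith
    have hn : 1 < nrm (m - 1) := by rwa [padicNorm_sub_eq_left (by simpa using hm1)]
    generalize m - 1 = n at hn
    have hn2 : nrm (n ^ 2 - 1) = nrm n ^ 2 := by
      rw [padicNorm_sub_eq_left, pow_two, padicNorm.mul, pow_two]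
      rw [padicNorm.one, pow_two, padicNorm.mul]
      nlinarith
    have hne : n ^ 2 - 1 ≠ 0 := ne_of (by rw [hn2]; positivity)
    refine ⟨ne_of (by linarith), _, ?_, ?_, ?_, _, hseed n hne⟩
    · exact div_ne_zero two_ne_zero hne
    · rw [padicNorm.div, padicNorm_two_two, hn2, div_lt_one (by positivity)]
      nlinarith
    · rw [padicNorm.mul, padicNorm.div, padicNorm_two_two, hn2]
      field_simp
      linarith
  · have hm1 : nrm m < 1 / 2 := by
      have ht0 : 0 < nrm t := lt_of_le_of_ne (padicNorm.nonneg _) (padicNorm.nonzero h₀).symm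
      rw [hmn, div_lt_iff₀ hpos]
      rcases lt_or_gt_of_ne hcase with hlt | hgt
      · rw [padicNorm_one_sub (padicNorm_pow_lt_one hlt)]
        linarith
      · have : nrm (1 - t ^ 2) = nrm t ^ 2 := by
          have hsq : nrm (t ^ 2) = nrm t ^ 2 := by rw [pow_two, padicNorm.mul, pow_two]
          rw [← padicNorm.neg, neg_sub, padicNorm_sub_eq_left, hsq]
          rw [padicNorm.one, hsq]
          nlinarith
        rw [this]
        nlinarith
    have hn : nrm (m - 1) = 1 := by
      rw [← padicNorm.neg, neg_sub, padicNorm_one_sub (by linarith)]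
    have hm2 : nrm (m - 2) = 1 / 2 := by
      rw [← padicNorm.neg, neg_sub, padicNorm_sub_eq_left, padicNorm_two_two]
      rwa [padicNorm_two_two]
    have he : (m - 1) ^ 2 - 1 = m * (m - 2) := by ring
    have hne : (m - 1) ^ 2 - 1 ≠ 0 := by
      rw [he]
      exact mul_ne_zero hm0 (ne_of (by rw [hm2]; norm_num))
    have hn0 : m - 1 ≠ 0 := ne_of (by rw [hn]; norm_num)
    have hx : nrm (-(2 / ((m - 1) ^ 2 - 1))⁻¹) < 1 := by
      rw [padicNorm.neg, inv_div, padicNorm.div, padicNorm_two_two, he, padicNorm.mul, hm2]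
      linarith
    refine ⟨hn0, -(2 / ((m - 1) ^ 2 - 1))⁻¹, ?_, hx, ?_, _,
      (hseed _ hne).neg_inv_left (div_ne_zero two_ne_zero hne)
        (div_ne_zero (mul_ne_zero two_ne_zero hn0) hne)⟩
    · exact neg_ne_zero.2 (inv_ne_zero (div_ne_zero two_ne_zero hne))
    · rwa [padicNorm.mul, hn, one_mul]

theorem nearOrigin_neg (n : ℚ) : nearOrigin n ⊆ nearOrigin (-n) := by
  rintro x ⟨hx0, hx, hnx, y, hy⟩
  exact ⟨hx0, hx, by rwa [neg_mul, padicNorm.neg], -y, hy.neg_neg⟩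

end TwoAdic

section RealPoints

open Filter Topology

/-- The slope `y / x` of the point of the identity component of the real cubic over `x`. -/
noncomputable def cubicSlope (n x : ℝ) : ℝ :=
  2 * n / (1 - 2 * x - x ^ 2 + √((1 - 2 * x - x ^ 2) ^ 2 + 4 * n ^ 2 * x ^ 2))

variable {n : ℝ}

theorem cubicSlope_denom_pos (hn : 0 < n) (x : ℝ) :
    0 < 1 - 2 * x - x ^ 2 + √((1 - 2 * x - x ^ 2) ^ 2 + 4 * n ^ 2 * x ^ 2) := by
  rcases eq_or_ne x 0 with rfl | hx
  · norm_num
  · have : |1 - 2 * x - x ^ 2| < √((1 - 2 * x - x ^ 2) ^ 2 + 4 * n ^ 2 * x ^ 2) := by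
      rw [← Real.sqrt_sq_eq_abs]
      have : 0 < n ^ 2 * x ^ 2 := by positivity
      exact Real.sqrt_lt_sqrt (sq_nonneg _) (by linarith)
    linarith [neg_abs_le (1 - 2 * x - x ^ 2)]

theorem cubicSlope_pos (hn : 0 < n) (x : ℝ) : 0 < cubicSlope n x :=
  div_pos (by positivity) (cubicSlope_denom_pos hn x)

theorem continuous_cubicSlope (hn : 0 < n) : Continuous (cubicSlope n) := by
  unfold cubicSlope
  exact Continuous.div (by fun_prop) (by fun_prop) fun x ↦ (cubicSlope_denom_pos hn x).ne'

theorem cubicSlope_zero (n : ℝ) : cubicSlope n 0 = n := by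
  unfold cubicSlope
  norm_num

theorem cubicSlope_spec (hn : 0 < n) (x : ℝ) :
    n * x ^ 2 * cubicSlope n x ^ 2 + (1 - 2 * x - x ^ 2) * cubicSlope n x = n := by
  have hpos := cubicSlope_denom_pos hn x
  have hsq := Real.sq_sqrt (show 0 ≤ (1 - 2 * x - x ^ 2) ^ 2 + 4 * n ^ 2 * x ^ 2 by positivity)
  unfold cubicSlope
  set w := √((1 - 2 * x - x ^ 2) ^ 2 + 4 * n ^ 2 * x ^ 2)
  generalize 1 - 2 * x - x ^ 2 = q at *
  field_simp
  linear_combination -hsq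

theorem cubicSlope_unique (hn : 0 < n) {x a : ℝ} (ha : 0 < a)
    (h : n * x ^ 2 * a ^ 2 + (1 - 2 * x - x ^ 2) * a = n) : a = cubicSlope n x := by
  have h' := cubicSlope_spec hn x
  have hb := cubicSlope_pos hn x
  generalize cubicSlope n x = b at *
  have : (a - b) * (n * x ^ 2 * (a * b) + n) = 0 := by linear_combination b * h - a * h'
  rcases mul_eq_zero.1 this with h0 | h0
  · linarith
  · have : 0 < n * x ^ 2 * (a * b) + n := by positivity
    linarith

theorem onCubic_cubicSlope (hn : 0 < n) (x : ℝ) : OnCubic n x (x * cubicSlope n x) := by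
  unfold OnCubic
  linear_combination x * cubicSlope_spec hn x

/-- `x` is the first coordinate of a rational point of the cubic with parameter `n`. -/
def RatPoint (n x : ℝ) : Prop :=
  (∃ a : ℚ, x = a) ∧ ∃ b : ℚ, cubicSlope n x = b

theorem RatPoint.zero (n : ℚ) : RatPoint n 0 := ⟨⟨0, by simp⟩, n, cubicSlope_zero _⟩

theorem OnCubic.ratPoint {n x y : ℚ} (hn : 0 < n) (h : OnCubic n x y) : RatPoint n x := by
  rcases eq_or_ne x 0 with rfl | hx
  · simpa using RatPoint.zero n
  have hnR : (0 : ℝ) < n := by exact_mod_cast hn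
  have hy : y ≠ 0 := h.right_ne_zero hn.ne' hx
  have aux {z : ℚ} (hz : OnCubic n x z) (hpos : 0 < z / x) : RatPoint n x := by
    refine ⟨⟨x, rfl⟩, z / x, (cubicSlope_unique hnR (by exact_mod_cast hpos) ?_).symm⟩
    have : n * x ^ 2 * (z / x) ^ 2 + (1 - 2 * x - x ^ 2) * (z / x) = n := by
      unfold OnCubic at hz
      field_simp
      linear_combination hz
    exact_mod_cast this
  rcases lt_or_gt_of_ne (div_ne_zero hy hx) with hlt | hgt
  · refine aux (h.neg_inv_right hy) ?_
    have : -y⁻¹ / x = -(y / x) / y ^ 2 := by field_simp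
    rw [this]
    exact div_pos (by linarith) (by positivity)
  · exact aux h hgt

theorem RatPoint.neg_inv {n : ℚ} (hn : 0 < n) {x : ℝ} (h : RatPoint n x) (hx : x ≠ 0) :
    RatPoint n (-x⁻¹) := by
  obtain ⟨⟨a, rfl⟩, b, hb⟩ := h
  have hnR : (0 : ℝ) < n := by exact_mod_cast hn
  have hb0 : b ≠ 0 := by
    have := cubicSlope_pos hnR a
    rw [hb] at this
    exact_mod_cast this.ne'
  have ha0 : a ≠ 0 := by exact_mod_cast hx
  have hc := onCubic_cubicSlope hnR a
  rw [hb] at hc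
  have hc' : OnCubic n a (a * b) := by
    unfold OnCubic at *
    exact_mod_cast hc
  simpa using (hc'.neg_inv_left ha0 (mul_ne_zero ha0 hb0)).ratPoint hn

/-- The denominator of the difference of two points on the identity component. -/
noncomputable def subDenom (n x₁ x₂ : ℝ) : ℝ :=
  (1 + x₁ * cubicSlope n x₁ * (x₂ * cubicSlope n x₂)) *
    (n * (1 + x₁ * cubicSlope n x₁ * (x₂ * cubicSlope n x₂)) + (x₂ - x₁) * (x₂ * cubicSlope n x₂))

/-- The quotient by `x₂ - x₁` of the numerator of the difference of two points. -/
noncomputable def subNum (n x₁ x₂ : ℝ) : ℝ :=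
  (x₂ - x₁) * (x₁ * cubicSlope n x₁) * (x₂ * cubicSlope n x₂) ^ 2
    - (1 + x₁ * cubicSlope n x₁ * (x₂ * cubicSlope n x₂)) *
      (cubicSlope n x₂ + n * (x₂ * cubicSlope n x₂) * (x₂ * cubicSlope n x₂ - x₁ * cubicSlope n x₁))

theorem RatPoint.sub {n : ℚ} (hn : 0 < n) {x₁ x₂ : ℝ} (h₁ : RatPoint n x₁) (h₂ : RatPoint n x₂)
    (hd : subDenom n x₁ x₂ ≠ 0) :
    RatPoint n ((x₂ - x₁) * subNum n x₁ x₂ / subDenom n x₁ x₂) := by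
  have hnR : (0 : ℝ) < n := by exact_mod_cast hn
  rcases eq_or_ne x₂ 0 with rfl | hx₂
  · have : (0 - x₁) * subNum n x₁ 0 / subDenom n x₁ 0 = x₁ := by
      simp only [subNum, subDenom, cubicSlope_zero]
      field_simp
      ring
    rwa [this]
  rcases eq_or_ne x₁ x₂ with rfl | hne
  · simpa using RatPoint.zero n
  obtain ⟨⟨a₁, rfl⟩, b₁, hb₁⟩ := h₁
  obtain ⟨⟨a₂, rfl⟩, b₂, hb₂⟩ := h₂
  have hc₁ := onCubic_cubicSlope hnR a₁
  have hc₂ := onCubic_cubicSlope hnR a₂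
  have hb₂_ne := (cubicSlope_pos hnR a₂).ne'
  simp only [subNum, subDenom, hb₁, hb₂] at *
  have hc₁' : OnCubic n a₁ (a₁ * b₁) := by
    unfold OnCubic at *
    exact_mod_cast hc₁
  have hc₂' : OnCubic n a₂ (a₂ * b₂) := by
    unfold OnCubic at *
    exact_mod_cast hc₂
  obtain ⟨hd₁, hd₂⟩ := mul_ne_zero_iff.1 hd
  obtain ⟨z, hz⟩ := hc₁'.sub hc₂' (by exact_mod_cast hx₂) (by exact_mod_cast hb₂_ne)
    (by exact_mod_cast hne) (by exact_mod_cast hd₁) (by exact_mod_cast hd₂)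
  have := hz.ratPoint hn
  push_cast at this
  exact this

theorem continuous_subDenom (hn : 0 < n) :
    Continuous fun p : ℝ × ℝ ↦ subDenom n p.1 p.2 := by
  have := continuous_cubicSlope hn
  unfold subDenom
  fun_prop

theorem continuous_subNum (hn : 0 < n) :
    Continuous fun p : ℝ × ℝ ↦ subNum n p.1 p.2 := by
  have := continuous_cubicSlope hn
  unfold subNum
  fun_prop

/-- The numerator of the displacement caused by subtracting the point over `e` from the point
over `x`, divided by `-e`. -/
noncomputable def stepNum (n x e : ℝ) : ℝ :=
  x * (n * (x * cubicSlope n x) * cubicSlope n e + (e - x) * cubicSlope n e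
      + x * cubicSlope n x * cubicSlope n e * (n + n * (x * cubicSlope n x) * e * cubicSlope n e
        + (e - x) * e * cubicSlope n e)
      - 2 * cubicSlope n e - e * cubicSlope n e + n * e * cubicSlope n e ^ 2)
    - (-cubicSlope n e + (e - x) * ((e - x) * (x * cubicSlope n x) * e * cubicSlope n e ^ 2
      - x * cubicSlope n x * cubicSlope n e * (cubicSlope n e
        + n * e * cubicSlope n e * (e * cubicSlope n e - x * cubicSlope n x))
      - n * cubicSlope n e * (e * cubicSlope n e - x * cubicSlope n x)))

theorem continuous_stepNum (hn : 0 < n) :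
    Continuous fun p : ℝ × ℝ ↦ stepNum n p.1 p.2 := by
  have := continuous_cubicSlope hn
  unfold stepNum
  fun_prop

theorem sub_eq_step (hn : 0 < n) {x e : ℝ} (hd : subDenom n x e ≠ 0) :
    (e - x) * subNum n x e / subDenom n x e = x - e * (stepNum n x e / subDenom n x e) := by
  field_simp
  have h := cubicSlope_spec hn e
  unfold subDenom subNum stepNum
  generalize cubicSlope n e = b at *
  generalize cubicSlope n x = a at *
  linear_combination x * h

theorem stepNum_zero_pos (hn : 0 < n) (x : ℝ) : 0 < stepNum n x 0 := by
  have h : stepNum n x 0 = n * (1 - 2 * x - x ^ 2 + 2 * n * x ^ 2 * cubicSlope n x) := by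
    simp only [stepNum, cubicSlope_zero]
    ring
  have hs := cubicSlope_spec hn x
  have hb := cubicSlope_pos hn x
  rw [h]
  generalize cubicSlope n x = b at *
  have : (1 - 2 * x - x ^ 2 + 2 * n * x ^ 2 * b) = (n + n * x ^ 2 * b ^ 2) / b := by
    field_simp
    linear_combination hs
  rw [this]
  positivity

theorem subDenom_zero (n x : ℝ) : subDenom n x 0 = n := by
  simp [subDenom]

theorem exists_ratPoint_near_zero {n : ℚ} (hn : 0 < n) (hinf : {x : ℝ | RatPoint n x}.Infinite)
    {e : ℝ} (he : 0 < e) : ∃ x, RatPoint n x ∧ -e < x ∧ x < 0 := by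
  have hnR : (0 : ℝ) < n := by exact_mod_cast hn
  have hinf' : ({x : ℝ | RatPoint n x} ∩ Set.Icc (-1) 1).Infinite := by
    intro hfin
    refine hinf ((hfin.union (hfin.image fun x ↦ -x⁻¹)).subset fun x hx ↦ ?_)
    by_cases hx1 : x ∈ Set.Icc (-1 : ℝ) 1
    · exact Or.inl ⟨hx, hx1⟩
    · have hx0 : x ≠ 0 := by
        rintro rfl
        norm_num at hx1
      have habs : 1 < |x| := by
        by_contra hle
        exact hx1 (abs_le.1 (not_lt.1 hle))
      refine Or.inr ⟨-x⁻¹, ⟨hx.neg_inv hn hx0, abs_le.1 ?_⟩, by simp⟩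
      rw [abs_neg, abs_inv]
      exact inv_le_one_of_one_le₀ habs.le
  obtain ⟨L, -, hL⟩ := hinf'.exists_accPt_of_subset_isCompact isCompact_Icc Set.inter_subset_right
  have hD := (continuous_subDenom hnR).continuousAt (x := (L, L))
  have hN := (continuous_subNum hnR).continuousAt (x := (L, L))
  have hb := cubicSlope_pos hnR L
  have hD0 : 0 < subDenom n L L := by
    have : subDenom n L L = n * (1 + (L * cubicSlope n L) ^ 2) ^ 2 := by
      unfold subDenom; ring
    rw [this]
    positivity
  have hN0 : subNum n L L < 0 := by
    have : subNum n L L = -((1 + (L * cubicSlope n L) ^ 2) * cubicSlope n L) := by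
      unfold subNum; ring
    rw [this, neg_lt_zero]
    positivity
  have hS : Tendsto (fun p : ℝ × ℝ ↦ (p.2 - p.1) * subNum n p.1 p.2 / subDenom n p.1 p.2)
      (𝓝 (L, L)) (𝓝 0) := by
    have : ContinuousAt
        (fun p : ℝ × ℝ ↦ (p.2 - p.1) * subNum n p.1 p.2 / subDenom n p.1 p.2) (L, L) :=
      ContinuousAt.div (by fun_prop) hD hD0.ne'
    simpa [ContinuousAt] using this
  have hev := ((hD.eventually (lt_mem_nhds hD0)).and (hN.eventually (gt_mem_nhds hN0))).and
    (hS.eventually (lt_mem_nhds (neg_lt_zero.2 he)))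
  rw [nhds_prod_eq] at hev
  obtain ⟨U, hU, hUP⟩ := eventually_prod_self_iff'.1 hev
  have hfreq := accPt_iff_frequently.1 hL
  obtain ⟨x₁, ⟨hne₁, hx₁⟩, hU₁⟩ := (hfreq.and_eventually hU).exists
  obtain ⟨x₂, ⟨hne₂, hx₂⟩, hU₂, hne⟩ :=
    (hfreq.and_eventually ((show ∀ᶠ x in 𝓝 L, x ∈ U from hU).and
      (eventually_ne_nhds hne₁.symm))).exists
  have main {a b : ℝ} (ha : a ∈ U) (hb : b ∈ U) (hab : a < b) (hra : RatPoint n a)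
      (hrb : RatPoint n b) : ∃ x, RatPoint n x ∧ -e < x ∧ x < 0 := by
    obtain ⟨⟨h₁, h₂⟩, h₃⟩ := hUP a ha b hb
    exact ⟨_, hra.sub hn hrb h₁.ne', h₃,
      div_neg_of_neg_of_pos (mul_neg_of_pos_of_neg (sub_pos.2 hab) h₂) h₁⟩
  rcases lt_or_gt_of_ne hne with hlt | hgt
  · exact main hU₂ hU₁ hlt hx₂.1 hx₁.1
  · exact main hU₁ hU₂ hgt hx₁.1 hx₂.1

theorem exists_ratPoint_between {n : ℚ} (hn : 0 < n) (hinf : {x : ℝ | RatPoint n x}.Infinite)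
    {a b : ℝ} (ha : 0 ≤ a) (hab : a < b) : ∃ x, RatPoint n x ∧ a < x ∧ x < b := by
  have hnR : (0 : ℝ) < n := by exact_mod_cast hn
  have hev : ∀ᶠ e in 𝓝 (0 : ℝ), ∀ x ∈ Set.Icc 0 a, 0 < subDenom n x e ∧ 0 < stepNum n x e ∧
      a - b < e * (stepNum n x e / subDenom n x e) := by
    refine isCompact_Icc.eventually_forall_of_forall_eventually fun x _ ↦ ?_
    have hD : ContinuousAt (fun p : ℝ × ℝ ↦ subDenom n p.2 p.1) (0, x) :=
      ((continuous_subDenom hnR).comp continuous_swap).continuousAt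
    have hN : ContinuousAt (fun p : ℝ × ℝ ↦ stepNum n p.2 p.1) (0, x) :=
      ((continuous_stepNum hnR).comp continuous_swap).continuousAt
    have hD0 : 0 < subDenom n x 0 := by rwa [subDenom_zero]
    have hS : ContinuousAt
        (fun p : ℝ × ℝ ↦ p.1 * (stepNum n p.2 p.1 / subDenom n p.2 p.1)) (0, x) :=
      continuousAt_fst.mul (hN.div hD hD0.ne')
    refine (hD.eventually (lt_mem_nhds hD0)).and
      ((hN.eventually (lt_mem_nhds (stepNum_zero_pos hnR x))).and
        (hS.eventually (lt_mem_nhds ?_)))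
    simpa using hab
  obtain ⟨r, hr, hball⟩ := Metric.eventually_nhds_iff.1 hev
  obtain ⟨e, hRe, her, he0⟩ := exists_ratPoint_near_zero hn hinf hr
  have hstep := hball (y := e) (by rw [Real.dist_eq, abs_lt]; constructor <;> linarith)
  have hcont : ContinuousOn (fun x ↦ -e * (stepNum n x e / subDenom n x e)) (Set.Icc 0 a) := by
    refine continuousOn_const.mul (ContinuousOn.div ?_ ?_ fun x hx ↦ (hstep x hx).1.ne')
    · exact ((continuous_stepNum hnR).comp (by fun_prop :
        Continuous fun x : ℝ ↦ (x, e))).continuousOn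
    · exact ((continuous_subDenom hnR).comp (by fun_prop :
        Continuous fun x : ℝ ↦ (x, e))).continuousOn
  obtain ⟨x₀, hx₀, hmin⟩ := isCompact_Icc.exists_isMinOn (Set.nonempty_Icc.2 ha) hcont
  set c := -e * (stepNum n x₀ e / subDenom n x₀ e) with hc
  have hc0 : 0 < c := mul_pos (by linarith) (div_pos (hstep x₀ hx₀).2.1 (hstep x₀ hx₀).1)
  by_contra hnone
  have hind (k : ℕ) : ∃ x ∈ Set.Icc 0 a, RatPoint n x ∧ k * c ≤ x := by
    induction k with
    | zero => exact ⟨0, ⟨le_rfl, ha⟩, RatPoint.zero n, by simp⟩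
    | succ k ih =>
      obtain ⟨x, hx, hRx, hkx⟩ := ih
      obtain ⟨h₁, h₂, h₃⟩ := hstep x hx
      have hR := hRx.sub hn hRe h₁.ne'
      rw [sub_eq_step hnR h₁.ne'] at hR
      have hge : c ≤ -e * (stepNum n x e / subDenom n x e) := hmin hx
      refine ⟨_, ⟨by linarith [hx.1], ?_⟩, hR, by push_cast; linarith⟩
      by_contra hgt
      exact hnone ⟨_, hR, not_le.1 hgt, by linarith [hx.2]⟩
  obtain ⟨k, hk⟩ := exists_nat_gt (a / c)
  obtain ⟨x, hx, -, hkx⟩ := hind k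
  rw [div_lt_iff₀ hc0] at hk
  linarith [hx.2]

end RealPoints

theorem exists_rat_euclDist_eq {P Q : ℝ × ℝ} (r : ℚ)
    (h : (P.1 - Q.1) ^ 2 + (P.2 - Q.2) ^ 2 = (r : ℝ) ^ 2) : ∃ q : ℚ, euclDist P Q = q :=
  ⟨|r|, by rw [euclDist, h, Real.sqrt_sq_eq_abs, Rat.cast_abs]⟩

theorem ratDists_of_onCubic {m k n x y : ℚ} (hk : k ^ 2 = 1 + m ^ 2) (hn : n ^ 2 = (m - 1) ^ 2)
    (hx : x ≠ 0) (hy : y ≠ 0) (h : OnCubic n x y) :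
    RatDists (((m + (1 / x - x) / 2) / (1 + m ^ 2) : ℚ),
      m * ((m + (1 / x - x) / 2) / (1 + m ^ 2) : ℚ)) := by
  have hk0 : k ≠ 0 := by
    rintro rfl
    nlinarith [sq_nonneg m]
  have hp : (m + (1 / x - x) / 2) / (1 + m ^ 2) * k ^ 2 = m + (1 / x - x) / 2 := by
    rw [← hk]; field_simp
  have hxy : 1 / x - x - 2 = n * (1 / y - y) := by
    unfold OnCubic at h
    field_simp
    linear_combination h
  generalize (m + (1 / x - x) / 2) / (1 + m ^ 2) = p at hp ⊢
  have h₁ : p ^ 2 + (m * p - 1) ^ 2 = ((1 / x + x) / 2 / k) ^ 2 := by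
    have : (p ^ 2 + (m * p - 1) ^ 2) * k ^ 2 = ((1 / x + x) / 2) ^ 2 := by
      have e : (p ^ 2 + (m * p - 1) ^ 2) * k ^ 2 = (p * k ^ 2 - m) ^ 2 + 1 := by
        linear_combination (1 - p ^ 2 * k ^ 2) * hk
      rw [e, hp]
      field_simp
      ring
    rw [div_pow, eq_div_iff (pow_ne_zero 2 hk0), this]
  have h₂ : (p - 1) ^ 2 + (m * p - 1) ^ 2 = (n * (1 / y + y) / 2 / k) ^ 2 := by
    have : ((p - 1) ^ 2 + (m * p - 1) ^ 2) * k ^ 2 = (n * (1 / y + y) / 2) ^ 2 := by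
      have e : ((p - 1) ^ 2 + (m * p - 1) ^ 2) * k ^ 2 =
          (p * k ^ 2 - m - 1) ^ 2 + (m - 1) ^ 2 := by
        linear_combination (2 - p ^ 2 * k ^ 2) * hk
      have e' : p * k ^ 2 - m - 1 = n * (1 / y - y) / 2 := by
        rw [hp, ← hxy]; ring
      rw [e, e', ← hn]
      field_simp
      ring
    rw [div_pow, eq_div_iff (pow_ne_zero 2 hk0), this]
  refine ⟨exists_rat_euclDist_eq (p * k) ?_, exists_rat_euclDist_eq ((1 / x + x) / 2 / k) ?_,
    exists_rat_euclDist_eq (n * (1 / y + y) / 2 / k) ?_⟩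
  · have : (p - 0) ^ 2 + (m * p - 0) ^ 2 = (p * k) ^ 2 := by linear_combination -p ^ 2 * hk
    simp only
    exact_mod_cast this
  · simp only [sub_zero]
    exact_mod_cast h₁
  · simp only
    exact_mod_cast h₂

theorem Real.exists_pos_inv_sub_eq (w : ℝ) : ∃ x > 0, (1 / x - x) / 2 = w := by
  have h : |w| < √(w ^ 2 + 1) := by
    rw [← Real.sqrt_sq_eq_abs]
    exact Real.sqrt_lt_sqrt (sq_nonneg _) (by linarith)
  have hpos : 0 < √(w ^ 2 + 1) - w := by linarith [le_abs_self w]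
  refine ⟨_, hpos, ?_⟩
  have hsq := Real.sq_sqrt (show 0 ≤ w ^ 2 + 1 by positivity)
  field_simp
  linear_combination -hsq

/-- A set that is dense in `(0, ∞)` has dense image under `x ↦ A + B (1/x - x) / 2`. -/
theorem dense_image_inv_sub {s : Set ℝ} {A B : ℝ} (hB : B ≠ 0)
    (hs : ∀ a b : ℝ, 0 ≤ a → a < b → ∃ x ∈ s, a < x ∧ x < b) :
    Dense ((fun x ↦ A + B * ((1 / x - x) / 2)) '' (s ∩ Set.Ioi 0)) := by
  intro p
  obtain ⟨x, hx, hxp⟩ := Real.exists_pos_inv_sub_eq ((p - A) / B)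
  have hp : A + B * ((1 / x - x) / 2) = p := by rw [hxp]; field_simp; ring
  rw [← hp]
  refine mem_closure_image (f := fun x : ℝ ↦ A + B * ((1 / x - x) / 2)) (x := x) ?_ ?_
  · have : ContinuousAt (fun x : ℝ ↦ 1 / x) x := continuousAt_const.div continuousAt_id hx.ne'
    fun_prop
  · refine Metric.mem_closure_iff.2 fun e he ↦ ?_
    obtain ⟨z, hz, h₁, h₂⟩ := hs x (x + e) hx.le (by linarith)
    refine ⟨z, ⟨hz, hx.trans h₁⟩, ?_⟩
    rw [Real.dist_eq, abs_lt]
    constructor <;> linarith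

theorem dense_ratDists_of_slope {t : ℚ} (h₁ : t ≠ -1) (h₀ : t ≠ 0) (h₁' : t ≠ 1) :
    Dense {p : ℝ | RatDists (p, ((2 * t / (1 - t ^ 2) : ℚ) : ℝ) * p)} := by
  obtain ⟨hn, hne⟩ := nearOrigin_nonempty h₁ h₀ h₁'
  have ht := one_sub_sq_ne_zero h₁ h₁'
  have hk : ((1 + t ^ 2) / (1 - t ^ 2)) ^ 2 = 1 + (2 * t / (1 - t ^ 2)) ^ 2 := by
    field_simp
    ring
  generalize 2 * t / (1 - t ^ 2) = m at *
  have hpos : 0 < |m - 1| := abs_pos.2 hn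
  have hposR : (0 : ℝ) < (|m - 1| : ℚ) := by exact_mod_cast hpos
  have hne' : (nearOrigin |m - 1|).Nonempty := by
    rcases abs_choice (m - 1) with h | h <;> rw [h]
    · exact hne
    · exact hne.mono (nearOrigin_neg _)
  have hinf : {x : ℝ | RatPoint (|m - 1| : ℚ) x}.Infinite := by
    refine ((nearOrigin.infinite hpos.ne' hne').image
      (Rat.cast_injective (α := ℝ)).injOn).mono ?_
    rintro _ ⟨x, ⟨-, -, -, y, hy⟩, rfl⟩
    exact hy.ratPoint hpos
  have hB : (0 : ℝ) < 1 + (m : ℝ) ^ 2 := by positivity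
  refine (dense_image_inv_sub (A := m / (1 + m ^ 2)) (B := 1 / (1 + m ^ 2))
    (s := {x : ℝ | RatPoint (|m - 1| : ℚ) x}) (by positivity)
    fun a b ha hab ↦ exists_ratPoint_between hpos hinf ha hab).mono ?_
  rintro _ ⟨_, ⟨⟨⟨x, rfl⟩, b, hb⟩, hx⟩, rfl⟩
  have hx0 : x ≠ 0 := by
    have : (0 : ℝ) < x := hx
    exact_mod_cast this.ne'
  have hb0 : b ≠ 0 := by
    have := cubicSlope_pos hposR x
    rw [hb] at this
    exact_mod_cast this.ne'
  have hc := onCubic_cubicSlope hposR x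
  rw [hb] at hc
  have hc' : OnCubic |m - 1| x (x * b) := by
    unfold OnCubic at *
    exact_mod_cast hc
  have := ratDists_of_onCubic hk (sq_abs _) hx0 (mul_ne_zero hx0 hb0) hc'
  have e : (m : ℝ) / (1 + m ^ 2) + 1 / (1 + m ^ 2) * ((1 / x - x) / 2) =
      ((m + (1 / x - x) / 2) / (1 + m ^ 2) : ℚ) := by
    push_cast
    ring
  simp only [Set.mem_ofPred_eq, e]
  exact this

theorem dense_ratDists_vertical : Dense {y : ℝ | RatDists (0, y)} := by
  refine (dense_image_inv_sub (A := 1) (B := 1) (s := Set.range ((↑) : ℚ → ℝ)) one_ne_zero ?_).mono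
    ?_
  · intro a b _ hab
    obtain ⟨q, h⟩ := exists_rat_btwn hab
    exact ⟨q, ⟨q, rfl⟩, h⟩
  · rintro _ ⟨_, ⟨⟨x, rfl⟩, hx⟩, rfl⟩
    have hx0 : (x : ℝ) ≠ 0 := ne_of_gt hx
    refine ⟨exists_rat_euclDist_eq (1 + (1 / x - x) / 2) ?_,
      exists_rat_euclDist_eq ((1 / x - x) / 2) ?_, exists_rat_euclDist_eq ((1 / x + x) / 2) ?_⟩
    all_goals
      push_cast
      field_simp
      ring

theorem stmt_2 :
    (∀ t : ℚ, t ≠ -1 → t ≠ 0 → t ≠ 1 →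
      ∀ P ∈ {Q : ℝ × ℝ | Q.2 = ((2 * t / (1 - t ^ 2) : ℚ) : ℝ) * Q.1},
        P ∈ closure {Q : ℝ × ℝ |
          Q.2 = ((2 * t / (1 - t ^ 2) : ℚ) : ℝ) * Q.1 ∧ RatDists Q}) ∧
    ∀ P ∈ {Q : ℝ × ℝ | Q.1 = 0},
      P ∈ closure {Q : ℝ × ℝ | Q.1 = 0 ∧ RatDists Q} := by
  constructor
  · rintro t h₁ h₀ h₁' ⟨p, y⟩ (rfl : y = _ * p)
    refine map_mem_closure (f := fun p : ℝ ↦ (p, ((2 * t / (1 - t ^ 2) : ℚ) : ℝ) * p))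
      (by fun_prop) (dense_ratDists_of_slope h₁ h₀ h₁' p) fun q hq ↦ ⟨rfl, hq⟩
  · rintro ⟨z, y⟩ (rfl : z = 0)
    exact map_mem_closure (f := fun y : ℝ ↦ ((0 : ℝ), y)) (by fun_prop) (dense_ratDists_vertical y)
      fun q hq ↦ ⟨rfl, hq⟩
end

section
/- For every α₃ ∈ S′, the set of pairs (α₁, α₂) ∈ S′ × S′ with α₁ + α₂ = α₃ is infinite. -/
/-- `S′`: the set of rational numbers `α` such that `α² + 1` is the square of a rational. -/
def Sslope : Set ℚ := {α : ℚ | ∃ q : ℚ, α ^ 2 + 1 = q ^ 2}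

/-- `(X, Y)` lies on the elliptic curve `Y² = X ((X + 1)² + c² X)`, whose rational points
parametrize the decompositions `c = α₁ + α₂` with `α₁, α₂ ∈ S′`. -/
def OnCurve (c X Y : ℚ) : Prop := Y ^ 2 = X * ((X + 1) ^ 2 + c ^ 2 * X)

/-- The explicit duplication formula. -/
lemma OnCurve.double {c X Y : ℚ} (h : OnCurve c X Y) (hY : Y ≠ 0) :
    ∃ Y', OnCurve c ((X ^ 2 - 1) ^ 2 / (4 * Y ^ 2)) Y' := by
  refine ⟨(X ^ 2 - 1) * (X ^ 4 + 2 * (c ^ 2 + 2) * X ^ 3 + 6 * X ^ 2 + 2 * (c ^ 2 + 2) * X + 1)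
    / (8 * Y ^ 3), ?_⟩
  unfold OnCurve at *
  have hF : X * ((X + 1) ^ 2 + c ^ 2 * X) ≠ 0 := by rw [← h]; positivity
  have h6 : (8 * Y ^ 3) ^ 2 = 64 * (X * ((X + 1) ^ 2 + c ^ 2 * X)) ^ 3 := by rw [← h]; ring
  rw [div_pow, h6, h]
  generalize hG : X * ((X + 1) ^ 2 + c ^ 2 * X) = F at *
  field_simp
  rw [← hG]
  ring

/-- Translation by the 2-torsion point `(0, 0)`. -/
lemma OnCurve.inv {c X Y : ℚ} (h : OnCurve c X Y) (hX : X ≠ 0) :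
    OnCurve c X⁻¹ (Y / X ^ 2) := by
  unfold OnCurve at *
  rw [div_pow, h]
  field_simp
  ring

lemma padicValRat_two_four : padicValRat 2 4 = 2 := by
  have : (4 : ℚ) = ((2 : ℕ) : ℚ) ^ 2 := by norm_num
  rw [this, padicValRat.pow, padicValRat.self (by norm_num)]
  norm_num

lemma padicValRat_two_two : padicValRat 2 2 = 1 := by
  simpa using padicValRat.self (p := 2) (by norm_num)

/-- The valuation of a sum is that of the summand of smaller valuation; in contrast to
`padicValRat.add_eq_of_lt`, the second summand may vanish. -/
lemma padicValRat_add_eq_left {x y : ℚ} (hx : x ≠ 0)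
    (h : y ≠ 0 → padicValRat 2 x < padicValRat 2 y) :
    padicValRat 2 (x + y) = padicValRat 2 x ∧ x + y ≠ 0 := by
  by_cases hy : y = 0
  · simp [hy, hx]
  have hlt := h hy
  have hne : x + y ≠ 0 := by
    intro h0
    rw [eq_neg_of_add_eq_zero_left h0, padicValRat.neg] at hlt
    exact lt_irrefl _ hlt
  exact ⟨padicValRat.add_eq_of_lt hne hx hy hlt, hne⟩

lemma padicValRat_add_of_neg {x u : ℚ} (hx : padicValRat 2 x < 0) (hu : padicValRat 2 u = 0) :
    padicValRat 2 (x + u) = padicValRat 2 x ∧ x + u ≠ 0 :=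
  padicValRat_add_eq_left (by rintro rfl; simp at hx) fun _ => by rwa [hu]

lemma padicValRat_add_of_pos {x u : ℚ} (hx : 0 < padicValRat 2 x) (hu0 : u ≠ 0)
    (hu : padicValRat 2 u = 0) : padicValRat 2 (x + u) = 0 := by
  rw [add_comm, (padicValRat_add_eq_left hu0 fun _ => by rwa [hu]).1, hu]

lemma one_le_padicValRat_sub_one {w : ℚ} (hw : w ≠ 0) (hv : padicValRat 2 w = 0) (h1 : w ≠ 1) :
    1 ≤ padicValRat 2 (w - 1) := by
  have hd : (w.den : ℤ) ≠ 0 := by exact_mod_cast w.den_nz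
  have hvv : (padicValInt 2 w.num : ℤ) = padicValNat 2 w.den := by
    have := hv; rw [padicValRat] at this; omega
  have hodd : ¬ 2 ∣ w.den := by
    intro h2
    have h3 : 1 ≤ padicValNat 2 w.den := one_le_padicValNat_of_dvd w.den_nz h2
    have h4 : 2 ∣ w.num.natAbs := by
      apply dvd_of_one_le_padicValNat
      have : padicValInt 2 w.num = padicValNat 2 w.num.natAbs := rfl
      omega
    have := Nat.dvd_gcd h4 h2
    rw [w.reduced] at this
    omega
  have hd0 : padicValNat 2 w.den = 0 := padicValNat.eq_zero_of_not_dvd hodd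
  have hodd' : ¬ (2 : ℤ) ∣ w.num := by
    intro h2
    have h3 : 2 ∣ w.num.natAbs := by omega
    have h4 := one_le_padicValNat_of_dvd (p := 2) (by simpa using hw) h3
    have : padicValInt 2 w.num = padicValNat 2 w.num.natAbs := rfl
    omega
  have he : w - 1 = ((w.num - w.den : ℤ) : ℚ) / ((w.den : ℤ) : ℚ) := by
    have hq : (w.den : ℚ) ≠ 0 := by exact_mod_cast w.den_nz
    push_cast
    rw [sub_div, div_self hq, Rat.num_div_den]
  have hne : w.num - w.den ≠ 0 := by
    intro h0
    rw [h0] at he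
    simp only [Int.cast_zero, zero_div] at he
    exact h1 (sub_eq_zero.mp he)
  rw [he, padicValRat.div (by exact_mod_cast hne) (by exact_mod_cast hd), padicValRat.of_int,
    Int.cast_natCast, padicValRat.of_nat, hd0]
  have h5 : 2 ∣ (w.num - w.den).natAbs := by omega
  have h6 := one_le_padicValNat_of_dvd (p := 2) (by omega) h5
  have : padicValInt 2 (w.num - w.den) = padicValNat 2 (w.num - w.den).natAbs := rfl
  omega

/-- Close to the point at infinity, the leading term determines the valuation of the quadratic
factor of the curve equation. -/
lemma padicValRat_quadratic_factor {c X : ℚ} (hc : c ≠ 0) (hX : padicValRat 2 X < 0)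
    (hXc : padicValRat 2 X < 2 * padicValRat 2 c) :
    padicValRat 2 ((X + 1) ^ 2 + c ^ 2 * X) = 2 * padicValRat 2 X ∧
      (X + 1) ^ 2 + c ^ 2 * X ≠ 0 := by
  have hX0 : X ≠ 0 := by rintro rfl; simp at hX
  obtain ⟨h1, h1'⟩ := padicValRat_add_of_neg hX (u := 1) (by simp)
  have h2 : padicValRat 2 ((X + 1) ^ 2) = 2 * padicValRat 2 X := by
    rw [padicValRat.pow, h1]; norm_num
  have h3 : padicValRat 2 (c ^ 2 * X) = 2 * padicValRat 2 c + padicValRat 2 X := by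
    rw [padicValRat.mul (by positivity) hX0, padicValRat.pow]; norm_num
  rw [← h2]
  exact padicValRat_add_eq_left (pow_ne_zero 2 h1') fun _ => by rw [h2, h3]; linarith

lemma exists_onCurve_double_lt {c X Y : ℚ} (hc : c ≠ 0) (h : OnCurve c X Y)
    (hX : padicValRat 2 X < 0) (hXc : padicValRat 2 X < 2 * padicValRat 2 c) :
    ∃ X' Y', OnCurve c X' Y' ∧ padicValRat 2 X' < padicValRat 2 X := by
  have hX0 : X ≠ 0 := by rintro rfl; simp at hX
  obtain ⟨hq, hq0⟩ := padicValRat_quadratic_factor hc hX hXc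
  have hY2 : Y ^ 2 ≠ 0 := by rw [h]; exact mul_ne_zero hX0 hq0
  obtain ⟨Y', hY'⟩ := h.double (by rintro rfl; simp at hY2)
  refine ⟨_, Y', hY', ?_⟩
  have hsq : padicValRat 2 (X ^ 2) = 2 * padicValRat 2 X := by
    rw [padicValRat.pow]; norm_num
  obtain ⟨h1, h1'⟩ := padicValRat_add_of_neg (x := X ^ 2) (u := -1) (by rw [hsq]; linarith)
    (by simp)
  rw [← sub_eq_add_neg] at h1 h1'
  rw [padicValRat.div (pow_ne_zero 2 h1') (mul_ne_zero (by norm_num) hY2),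
    padicValRat.pow, h1, hsq, padicValRat.mul (by norm_num) hY2, h,
    padicValRat.mul hX0 hq0, hq, padicValRat_two_four]
  push_cast
  linarith

/-- For nonzero `c = 2w / (w² - 1)` the double of the point with `X = w²`, possibly translated
by `(0, 0)`, is 2-adically close to the point at infinity. -/
lemma exists_onCurve_near_infinity {c : ℚ} (hc : c ≠ 0) (h : c ∈ Sslope) :
    ∃ X Y, OnCurve c X Y ∧ padicValRat 2 X < 0 ∧ padicValRat 2 X < 2 * padicValRat 2 c := by
  obtain ⟨q, hq⟩ := h
  obtain ⟨w, hw⟩ : ∃ w, w = (1 + q) / c := ⟨_, rfl⟩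
  have hq1 : 1 + q ≠ 0 := by
    intro h0
    have : c ^ 2 = 0 := by linear_combination hq + (q - 1) * h0
    exact hc (by simpa using this)
  have hw0 : w ≠ 0 := by rw [hw]; exact div_ne_zero hq1 hc
  have hcw : c * (w ^ 2 - 1) = 2 * w := by
    rw [hw]; field_simp; linear_combination -hq
  have ha : w ^ 2 - 1 ≠ 0 := by
    intro h0; rw [h0] at hcw; apply hw0; linarith
  have hb : w ^ 2 + 1 ≠ 0 := by positivity
  have hd : w ^ 4 + 1 ≠ 0 := by positivity
  have hY : w * (w ^ 4 + 1) / (w ^ 2 - 1) ≠ 0 := by positivity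
  have hceq : c = 2 * w / (w ^ 2 - 1) := by rw [eq_div_iff ha, hcw]
  have hcurve : OnCurve c (w ^ 2) (w * (w ^ 4 + 1) / (w ^ 2 - 1)) := by
    unfold OnCurve
    rw [hceq]
    field_simp
    ring
  obtain ⟨Y, hcurve2⟩ := hcurve.double hY
  have hvc : padicValRat 2 c = 1 + padicValRat 2 w - padicValRat 2 (w ^ 2 - 1) := by
    rw [hceq, padicValRat.div (by positivity) ha, padicValRat.mul (by norm_num) hw0,
      padicValRat_two_two]
  have hfac : (w ^ 2) ^ 2 - 1 = (w ^ 2 - 1) * (w ^ 2 + 1) := by ring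
  have hnum : (w ^ 2) ^ 2 - 1 ≠ 0 := by rw [hfac]; exact mul_ne_zero ha hb
  have hvX : padicValRat 2
      (((w ^ 2) ^ 2 - 1) ^ 2 / (4 * (w * (w ^ 4 + 1) / (w ^ 2 - 1)) ^ 2)) =
      2 * (2 * padicValRat 2 (w ^ 2 - 1) + padicValRat 2 (w ^ 2 + 1) - 1 - padicValRat 2 w
        - padicValRat 2 (w ^ 4 + 1)) := by
    rw [padicValRat.div (pow_ne_zero 2 hnum) (mul_ne_zero (by norm_num) (pow_ne_zero 2 hY)),
      padicValRat.pow, hfac, padicValRat.mul ha hb,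
      padicValRat.mul (by norm_num) (pow_ne_zero 2 hY), padicValRat.pow,
      padicValRat.div (mul_ne_zero hw0 hd) ha, padicValRat.mul hw0 hd, padicValRat_two_four]
    push_cast
    ring
  have hX0 : ((w ^ 2) ^ 2 - 1) ^ 2 / (4 * (w * (w ^ 4 + 1) / (w ^ 2 - 1)) ^ 2) ≠ 0 :=
    div_ne_zero (pow_ne_zero 2 hnum) (mul_ne_zero (by norm_num) (pow_ne_zero 2 hY))
  have hv2 : padicValRat 2 (w ^ 2) = 2 * padicValRat 2 w := by
    rw [padicValRat.pow]; norm_num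
  have hv4 : padicValRat 2 (w ^ 4) = 4 * padicValRat 2 w := by
    rw [padicValRat.pow]; norm_num
  rcases lt_trichotomy (padicValRat 2 w) 0 with hv | hv | hv
  · have e1 := (padicValRat_add_of_neg (x := w ^ 2) (u := -1) (by linarith) (by simp)).1
    have e2 := (padicValRat_add_of_neg (x := w ^ 2) (u := 1) (by linarith) (by simp)).1
    have e3 := (padicValRat_add_of_neg (x := w ^ 4) (u := 1) (by linarith) (by simp)).1
    rw [← sub_eq_add_neg] at e1
    refine ⟨_, Y, hcurve2, ?_, ?_⟩ <;> rw [hvX] <;> linarith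
  · have hw1 : w ≠ 1 := by rintro rfl; simp at ha
    have hw1' : -w ≠ 1 := by
      intro h0; apply ha; linear_combination (-w + 1) * h0
    have f1 := one_le_padicValRat_sub_one hw0 hv hw1
    have f2 := one_le_padicValRat_sub_one (neg_ne_zero.mpr hw0) (by rwa [padicValRat.neg]) hw1'
    have hsplit : w ^ 2 - 1 = -((w - 1) * (-w - 1)) := by ring
    have e1 : 2 ≤ padicValRat 2 (w ^ 2 - 1) := by
      rw [hsplit, padicValRat.neg, padicValRat.mul (sub_ne_zero.mpr hw1) (sub_ne_zero.mpr hw1')]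
      linarith
    have e2 := (padicValRat_add_eq_left (x := 2) (y := w ^ 2 - 1) (by norm_num)
      fun _ => by rw [padicValRat_two_two]; linarith).1
    rw [padicValRat_two_two, show 2 + (w ^ 2 - 1) = w ^ 2 + 1 by ring] at e2
    have e3 := (padicValRat_add_eq_left (x := 2) (y := (w ^ 2) ^ 2 - 1) (by norm_num)
      fun _ => by rw [padicValRat_two_two, hfac, padicValRat.mul ha hb]; linarith).1
    rw [padicValRat_two_two, show 2 + ((w ^ 2) ^ 2 - 1) = w ^ 4 + 1 by ring] at e3
    refine ⟨_, _, hcurve2.inv hX0, ?_, ?_⟩ <;> rw [padicValRat.inv, hvX] <;> linarith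
  · have e1 := padicValRat_add_of_pos (x := w ^ 2) (u := -1) (by linarith) (by simp) (by simp)
    have e2 := padicValRat_add_of_pos (x := w ^ 2) (u := 1) (by linarith) (by simp) (by simp)
    have e3 := padicValRat_add_of_pos (x := w ^ 4) (u := 1) (by linarith) (by simp) (by simp)
    rw [← sub_eq_add_neg] at e1
    refine ⟨_, Y, hcurve2, ?_, ?_⟩ <;> rw [hvX] <;> linarith

lemma exists_onCurve_le_neg {c : ℚ} (hc : c ≠ 0) (h : c ∈ Sslope) (n : ℕ) :
    ∃ X Y, OnCurve c X Y ∧ padicValRat 2 X < 0 ∧ padicValRat 2 X < 2 * padicValRat 2 c ∧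
      padicValRat 2 X ≤ -n := by
  induction n with
  | zero =>
    obtain ⟨X, Y, h1, h2, h3⟩ := exists_onCurve_near_infinity hc h
    exact ⟨X, Y, h1, h2, h3, by simpa using h2.le⟩
  | succ n ih =>
    obtain ⟨X, Y, h1, h2, h3, h4⟩ := ih
    obtain ⟨X', Y', h5, h6⟩ := exists_onCurve_double_lt hc h1 h2 h3
    exact ⟨X', Y', h5, h6.trans h2, h6.trans h3, by push_cast; omega⟩

lemma half_sub_inv_mem_Sslope {s : ℚ} (hs : s ≠ 0) : (s - s⁻¹) / 2 ∈ Sslope :=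
  ⟨(s + s⁻¹) / 2, by field_simp; ring⟩

/-- A point of the curve yields a decomposition of `c`, with controlled difference. -/
lemma OnCurve.exists_decomposition {c X Y : ℚ} (h : OnCurve c X Y) (hX : X ≠ 0)
    (hX1 : X + 1 ≠ 0) : ∃ a ∈ Sslope, ∃ b ∈ Sslope, a + b = c ∧
      (a - b) ^ 2 = ((X + 1) ^ 2 + c ^ 2 * X) * (X - 1) ^ 2 / (X * (X + 1) ^ 2) := by
  obtain ⟨s, hs⟩ : ∃ s, s = (c * X + Y) / (X + 1) := ⟨_, rfl⟩
  obtain ⟨t, ht⟩ : ∃ t, t = (c * X - Y) / (X + 1) := ⟨_, rfl⟩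
  unfold OnCurve at h
  have hst : s * t = -X := by
    rw [hs, ht]; field_simp; linear_combination -h
  have hs0 : s ≠ 0 := by rintro rfl; apply hX; linarith
  have ht0 : t ≠ 0 := by rintro rfl; apply hX; linarith
  have hsi : s⁻¹ = -t / X := by
    rw [eq_div_iff hX, inv_mul_eq_iff_eq_mul₀ hs0]; linarith
  have hti : t⁻¹ = -s / X := by
    rw [eq_div_iff hX, inv_mul_eq_iff_eq_mul₀ ht0]; linarith
  refine ⟨_, half_sub_inv_mem_Sslope hs0, _, half_sub_inv_mem_Sslope ht0, ?_, ?_⟩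
  · rw [hsi, hti, hs, ht]; field_simp; ring
  · have hdiff : (s - s⁻¹) / 2 - (t - t⁻¹) / 2 = Y * (X - 1) / (X * (X + 1)) := by
      rw [hsi, hti, hs, ht]; field_simp; ring
    rw [hdiff, div_pow, mul_pow, h]
    field_simp

theorem stmt_14 (α₃ : ℚ) (h : α₃ ∈ Sslope) :
    {x : ℚ × ℚ | x.1 ∈ Sslope ∧ x.2 ∈ Sslope ∧ x.1 + x.2 = α₃}.Infinite := by
  by_cases hc : α₃ = 0
  · subst hc
    obtain ⟨f, hf⟩ : ∃ f : ℕ → ℚ, f = fun n => (((2 : ℚ) ^ n) - ((2 : ℚ) ^ n)⁻¹) / 2 := ⟨_, rfl⟩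
    have hmono : StrictMono f := by
      intro m n hmn
      have h1 : (2 : ℚ) ^ m < 2 ^ n := pow_lt_pow_right₀ (by norm_num) hmn
      have h2 : ((2 : ℚ) ^ n)⁻¹ < (2 ^ m)⁻¹ := inv_strictAnti₀ (by positivity) h1
      simp only [hf]
      linarith
    refine Set.infinite_of_injective_forall_mem (f := fun n => (f n, -f n))
      (fun m n hmn => hmono.injective (Prod.ext_iff.mp hmn).1) fun n => ?_
    have hmem : f n ∈ Sslope := by
      rw [hf]; exact half_sub_inv_mem_Sslope (by positivity)
    obtain ⟨q, hq⟩ := hmem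
    exact ⟨⟨q, hq⟩, ⟨q, by simpa using hq⟩, by simp⟩
  refine Set.Infinite.of_image (fun x => -padicValRat 2 ((x.1 - x.2) ^ 2))
    (Set.infinite_of_not_bddAbove ?_)
  rintro ⟨B, hB⟩
  obtain ⟨X, Y, hXY, hX, hXc, hXB⟩ := exists_onCurve_le_neg hc h (B.toNat + 1)
  have hX0 : X ≠ 0 := by rintro rfl; simp at hX
  obtain ⟨h1, h1'⟩ := padicValRat_add_of_neg hX (u := 1) (by simp)
  obtain ⟨h2, h2'⟩ := padicValRat_add_of_neg hX (u := -1) (by simp)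
  rw [← sub_eq_add_neg] at h2 h2'
  obtain ⟨hq, hq0⟩ := padicValRat_quadratic_factor hc hX hXc
  obtain ⟨a, ha, b, hb, hab, hdiff⟩ := hXY.exists_decomposition hX0 h1'
  have hle := hB ⟨(a, b), ⟨ha, hb, hab⟩, rfl⟩
  simp only at hle
  rw [hdiff, padicValRat.div (mul_ne_zero hq0 (pow_ne_zero 2 h2'))
    (mul_ne_zero hX0 (pow_ne_zero 2 h1')), padicValRat.mul hq0 (pow_ne_zero 2 h2'),
    padicValRat.mul hX0 (pow_ne_zero 2 h1'), padicValRat.pow, padicValRat.pow,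
    h1, h2, hq] at hle
  push_cast at hle hXB
  have := Int.self_le_toNat B
  linarith
end
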